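/- arXiv:2104.04949 — 3 statements merged into one kernel-verified Lean document; each statement's English description precedes it below -/
import Mathlib

section
/- Let p > 1 and -1 < α, β < p-1, and let μ be a positive Borel measure on [0,1). Then the following are equivalent: (1) H_μ is bounded from l^p_α to l^p_β; (2) μ is a (1+(β-α)/p)-Carleson measure; (3) μ[n] = O(n^{-1-(β-α)/p}). -/
open MeasureTheory

/-- Discrete derivative of a positive power, bounded below. -/
theorem exists_mul_rpow_le_rpow_sub {θ : ℝ} (hθ : 0 < θ) :
    ∃ c : ℝ, 0 < c ∧ ∀ x : ℝ, 0 ≤ x → c * (x + 1) ^ (θ - 1) ≤ (x + 1) ^ θ - x ^ θ := by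
  rcases le_total θ 1 with h | h
  · refine ⟨θ, hθ, fun x hx => ?_⟩
    have hx1 : 0 < x + 1 := by linarith
    have hs : (-1 : ℝ) ≤ -1 / (x + 1) := by rw [le_div_iff₀ hx1]; linarith
    have key := rpow_one_add_le_one_add_mul_self hs hθ.le h
    have e : 1 + -1 / (x + 1) = x / (x + 1) := by field_simp; ring
    rw [e, Real.div_rpow hx hx1.le, div_le_iff₀ (Real.rpow_pos_of_pos hx1 _)] at key
    rw [Real.rpow_sub_one hx1.ne']
    have e2 : (1 + θ * (-1 / (x + 1))) * (x + 1) ^ θ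
        = (x + 1) ^ θ - θ * ((x + 1) ^ θ / (x + 1)) := by ring
    linarith
  · refine ⟨1, one_pos, fun x hx => ?_⟩
    have hx1 : 0 < x + 1 := by linarith
    have h1 : (x + 1) ^ θ = (x + 1) ^ (θ - 1) * (x + 1) := by
      rw [← Real.rpow_add_one hx1.ne']; simp
    have h2 : x ^ θ ≤ (x + 1) ^ (θ - 1) * x := by
      rcases hx.eq_or_lt with rfl | hx
      · simp [Real.zero_rpow hθ.ne']
      · have : x ^ θ = x ^ (θ - 1) * x := by rw [← Real.rpow_add_one hx.ne']; simp
        rw [this]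
        exact mul_le_mul_of_nonneg_right
          (Real.rpow_le_rpow hx.le (by linarith) (by linarith)) hx.le
    rw [h1]; linarith

/-- Discrete derivative of a positive power, bounded above. -/
theorem exists_rpow_sub_le_mul_rpow {θ : ℝ} (hθ : 0 < θ) :
    ∃ c : ℝ, 0 < c ∧ ∀ x : ℝ, 0 ≤ x → (x + 1) ^ θ - x ^ θ ≤ c * (x + 1) ^ (θ - 1) := by
  rcases le_total 1 θ with h | h
  · refine ⟨θ, hθ, fun x hx => ?_⟩
    have hx1 : 0 < x + 1 := by linarith
    have hs : (-1 : ℝ) ≤ -1 / (x + 1) := by rw [le_div_iff₀ hx1]; linarith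
    have key := one_add_mul_self_le_rpow_one_add hs h
    have e : 1 + -1 / (x + 1) = x / (x + 1) := by field_simp; ring
    rw [e, Real.div_rpow hx hx1.le, le_div_iff₀ (Real.rpow_pos_of_pos hx1 _)] at key
    rw [Real.rpow_sub_one hx1.ne']
    have e2 : (1 + θ * (-1 / (x + 1))) * (x + 1) ^ θ
        = (x + 1) ^ θ - θ * ((x + 1) ^ θ / (x + 1)) := by ring
    linarith
  · refine ⟨1, one_pos, fun x hx => ?_⟩
    have hx1 : 0 < x + 1 := by linarith
    have h1 : (x + 1) ^ θ = (x + 1) ^ (θ - 1) * (x + 1) := by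
      rw [← Real.rpow_add_one hx1.ne']; simp
    have h2 : (x + 1) ^ (θ - 1) * x ≤ x ^ θ := by
      rcases hx.eq_or_lt with rfl | hx
      · simp [Real.zero_rpow hθ.ne']
      · have : x ^ θ = x ^ (θ - 1) * x := by rw [← Real.rpow_add_one hx.ne']; simp
        rw [this]
        exact mul_le_mul_of_nonneg_right
          (Real.rpow_le_rpow_of_nonpos hx (by linarith) (by linarith)) hx.le
    rw [h1]; linarith

theorem exists_sum_rpow_le {γ : ℝ} (hγ : -1 < γ) :
    ∃ c : ℝ, 0 < c ∧ ∀ N : ℕ,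
      ∑ n ∈ Finset.range N, ((n : ℝ) + 1) ^ γ ≤ c * (N : ℝ) ^ (γ + 1) := by
  obtain ⟨c, hc, h⟩ := exists_mul_rpow_le_rpow_sub (θ := γ + 1) (by linarith)
  refine ⟨c⁻¹, inv_pos.2 hc, fun N => ?_⟩
  have hsum : ∑ n ∈ Finset.range N, c * ((n : ℝ) + 1) ^ γ ≤ (N : ℝ) ^ (γ + 1) := by
    have tel := Finset.sum_range_sub (fun n : ℕ => (n : ℝ) ^ (γ + 1)) N
    rw [Nat.cast_zero, Real.zero_rpow (by linarith), sub_zero] at tel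
    rw [← tel]
    refine Finset.sum_le_sum fun n _ => ?_
    simpa using h n n.cast_nonneg
  rw [← Finset.mul_sum] at hsum
  rwa [le_inv_mul_iff₀ hc]

theorem exists_le_sum_rpow {γ : ℝ} (hγ : -1 < γ) :
    ∃ c : ℝ, 0 < c ∧ ∀ N : ℕ,
      c * (N : ℝ) ^ (γ + 1) ≤ ∑ n ∈ Finset.range N, ((n : ℝ) + 1) ^ γ := by
  obtain ⟨c, hc, h⟩ := exists_rpow_sub_le_mul_rpow (θ := γ + 1) (by linarith)
  refine ⟨c⁻¹, inv_pos.2 hc, fun N => ?_⟩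
  have hsum : (N : ℝ) ^ (γ + 1) ≤ ∑ n ∈ Finset.range N, c * ((n : ℝ) + 1) ^ γ := by
    have tel := Finset.sum_range_sub (fun n : ℕ => (n : ℝ) ^ (γ + 1)) N
    rw [Nat.cast_zero, Real.zero_rpow (by linarith), sub_zero] at tel
    rw [← tel]
    refine Finset.sum_le_sum fun n _ => ?_
    simpa using h n n.cast_nonneg
  rw [← Finset.mul_sum] at hsum
  rwa [inv_mul_le_iff₀ hc]

theorem exists_sum_rpow_tail_le {τ : ℝ} (hτ : 0 < τ) :
    ∃ c : ℝ, 0 < c ∧ ∀ M B : ℕ, 0 < M →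
      ∑ k ∈ Finset.range B, ((M : ℝ) + k + 1) ^ (-τ - 1) ≤ c * (M : ℝ) ^ (-τ) := by
  obtain ⟨c, hc, h⟩ := exists_mul_rpow_le_rpow_sub hτ
  refine ⟨c⁻¹, inv_pos.2 hc, fun M B hM => ?_⟩
  rw [le_inv_mul_iff₀ hc, Finset.mul_sum]
  have tel := Finset.sum_range_sub' (fun k : ℕ => ((M : ℝ) + k) ^ (-τ)) B
  have hB : 0 ≤ ((M : ℝ) + B) ^ (-τ) := by positivity
  refine le_trans (Finset.sum_le_sum fun k _ => ?_)
    (tel.le.trans (by rw [Nat.cast_zero, add_zero]; linarith))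
  have hx : 0 < (M : ℝ) + k := by positivity
  set x := (M : ℝ) + k
  have hx1 : 0 < x + 1 := by linarith
  have key := h x hx.le
  have e : (M : ℝ) + ((k + 1 : ℕ) : ℝ) = x + 1 := by push_cast; ring
  rw [e, Real.rpow_sub_one hx1.ne', Real.rpow_neg hx1.le, Real.rpow_neg hx.le]
  rw [Real.rpow_sub_one hx1.ne'] at key
  have hX : 0 < x ^ τ := Real.rpow_pos_of_pos hx _
  have hY : 0 < (x + 1) ^ τ := Real.rpow_pos_of_pos hx1 _
  have hXY : x ^ τ ≤ (x + 1) ^ τ := Real.rpow_le_rpow hx.le (by linarith) hτ.le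
  set X := x ^ τ
  set Y := (x + 1) ^ τ
  have e1 : c * (Y⁻¹ / (x + 1)) = c * (Y / (x + 1)) / (Y * Y) := by field_simp
  have e2 : X⁻¹ - Y⁻¹ = (Y - X) / (X * Y) := by field_simp
  rw [e1, e2]
  have : 0 ≤ Y - X := by linarith
  gcongr

/-- The Schur test sum for the kernel `(M + N) ^ (-σ)` and a power weight. -/
theorem exists_sum_kernel_le {σ δ : ℝ} (hδ : δ < 1) (hσδ : 1 < σ + δ) :
    ∃ c : ℝ, 0 < c ∧ ∀ M B : ℕ, 0 < M →
      ∑ n ∈ Finset.range B, ((M : ℝ) + n + 1) ^ (-σ) * ((n : ℝ) + 1) ^ (-δ)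
        ≤ c * (M : ℝ) ^ (1 - σ - δ) := by
  obtain ⟨c₁, hc₁, h₁⟩ := exists_sum_rpow_le (γ := -δ) (by linarith)
  obtain ⟨c₂, hc₂, h₂⟩ := exists_sum_rpow_tail_le (τ := σ + δ - 1) (by linarith)
  refine ⟨c₁ + c₂, by positivity, fun M B hM => ?_⟩
  have hM' : (0 : ℝ) < M := by exact_mod_cast hM
  have hmono : ∑ n ∈ Finset.range B, ((M : ℝ) + n + 1) ^ (-σ) * ((n : ℝ) + 1) ^ (-δ)
      ≤ ∑ n ∈ Finset.range (M + B), ((M : ℝ) + n + 1) ^ (-σ) * ((n : ℝ) + 1) ^ (-δ) :=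
    Finset.sum_le_sum_of_subset_of_nonneg (Finset.range_mono (by omega))
      fun _ _ _ => by positivity
  refine hmono.trans ?_
  rw [Finset.sum_range_add, add_mul]
  refine add_le_add ?_ ?_
  · calc _ ≤ ∑ n ∈ Finset.range M, (M : ℝ) ^ (-σ) * ((n : ℝ) + 1) ^ (-δ) := by
          refine Finset.sum_le_sum fun n _ => ?_
          refine mul_le_mul_of_nonneg_right ?_ (by positivity)
          exact Real.rpow_le_rpow_of_nonpos hM' (by linarith [(n.cast_nonneg : (0 : ℝ) ≤ n)])
            (by linarith)
      _ = (M : ℝ) ^ (-σ) * ∑ n ∈ Finset.range M, ((n : ℝ) + 1) ^ (-δ) := by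
          rw [Finset.mul_sum]
      _ ≤ (M : ℝ) ^ (-σ) * (c₁ * (M : ℝ) ^ (-δ + 1)) := by gcongr; exact h₁ M
      _ = c₁ * ((M : ℝ) ^ (-σ) * (M : ℝ) ^ (-δ + 1)) := by ring
      _ = c₁ * (M : ℝ) ^ (1 - σ - δ) := by
          rw [← Real.rpow_add hM']; congr 2; ring
  · calc _ ≤ ∑ k ∈ Finset.range B, ((M : ℝ) + k + 1) ^ (-(σ + δ - 1) - 1) := by
          refine Finset.sum_le_sum fun k _ => ?_
          have hk : (0 : ℝ) < (M : ℝ) + k + 1 := by positivity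
          have : -(σ + δ - 1) - 1 = -σ + -δ := by ring
          rw [this, Real.rpow_add hk]
          push_cast
          refine mul_le_mul_of_nonneg_right ?_ (by positivity)
          exact Real.rpow_le_rpow_of_nonpos hk (by linarith) (by linarith)
      _ ≤ c₂ * (M : ℝ) ^ (-(σ + δ - 1)) := h₂ M B hM
      _ = c₂ * (M : ℝ) ^ (1 - σ - δ) := by congr 2; ring

/-- Weighted Hilbert inequality for the kernel `(m + n) ^ (-σ)`, for finite sections. -/
theorem exists_weighted_hilbert_finite {p α β σ : ℝ} (hp : 1 < p) (hα' : α < p - 1)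
    (hβ : -1 < β) (hσ : 0 < σ) (hσe : σ * p = p + β - α) :
    ∃ C : ℝ, 0 < C ∧ ∀ (A B : ℕ) (a : ℕ → ℝ), (∀ n, 0 ≤ a n) →
      ∑ m ∈ Finset.range A, ((m : ℝ) + 1) ^ β *
          (∑ n ∈ Finset.range B, ((m : ℝ) + n + 2) ^ (-σ) * a n) ^ p
        ≤ C * ∑ n ∈ Finset.range B, ((n : ℝ) + 1) ^ α * a n ^ p := by
  have hp1 : 0 < p - 1 := by linarith
  have hp0 : 0 < p := by linarith
  obtain ⟨δ, hδl, hδu⟩ : ∃ δ : ℝ, max (1 - σ) (α / (p - 1)) < δ ∧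
      δ < min 1 ((β + 1) / (p - 1) + 1 - σ) := by
    refine exists_between (max_lt (lt_min (by linarith) ?_) (lt_min ?_ ?_))
    · have : 0 < (β + 1) / (p - 1) := div_pos (by linarith) hp1
      linarith
    · rw [div_lt_one hp1]; exact hα'
    · rw [div_lt_iff₀ hp1]
      have : ((β + 1) / (p - 1) + 1 - σ) * (p - 1) = β + 1 + (1 - σ) * (p - 1) := by
        field_simp; ring
      rw [this]; nlinarith
  obtain ⟨hδ1, hδ2⟩ := max_lt_iff.1 hδl
  obtain ⟨hδ3, hδ4⟩ := lt_min_iff.1 hδu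
  rw [div_lt_iff₀ hp1] at hδ2
  have hδ5 : (δ + σ - 1) * (p - 1) < β + 1 := by
    rw [← lt_div_iff₀ hp1]; linarith
  set e : ℝ := β + (1 - σ - δ) * (p - 1) with he
  obtain ⟨c₁, hc₁, h₁⟩ := exists_sum_kernel_le (σ := σ) (δ := δ) hδ3 (by linarith)
  obtain ⟨c₂, hc₂, h₂⟩ := exists_sum_kernel_le (σ := σ) (δ := -e)
    (by rw [he]; linarith) (by rw [he]; linarith)
  refine ⟨c₁ ^ (p - 1) * c₂, by positivity, fun A B a ha => ?_⟩
  have row : ∀ m : ℕ, ((m : ℝ) + 1) ^ β *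
      (∑ n ∈ Finset.range B, ((m : ℝ) + n + 2) ^ (-σ) * a n) ^ p ≤
      ∑ n ∈ Finset.range B, c₁ ^ (p - 1) * (((n : ℝ) + 1) ^ (δ * (p - 1)) * a n ^ p) *
        (((m : ℝ) + n + 2) ^ (-σ) * ((m : ℝ) + 1) ^ e) := by
    intro m
    have hm : (0 : ℝ) < (m : ℝ) + 1 := by positivity
    let w : ℕ → ℝ := fun n => ((m : ℝ) + n + 2) ^ (-σ) * ((n : ℝ) + 1) ^ (-δ)
    let f : ℕ → ℝ := fun n => ((n : ℝ) + 1) ^ δ * a n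
    have hw : ∀ n, 0 ≤ w n := fun n => by positivity
    have hf : ∀ n, 0 ≤ f n := fun n => mul_nonneg (by positivity) (ha n)
    have hS : ∑ n ∈ Finset.range B, ((m : ℝ) + n + 2) ^ (-σ) * a n
        = ∑ n ∈ Finset.range B, w n * f n := by
      refine Finset.sum_congr rfl fun n _ => ?_
      have hn : (0 : ℝ) < (n : ℝ) + 1 := by positivity
      have : ((n : ℝ) + 1) ^ (-δ) * ((n : ℝ) + 1) ^ δ = 1 := by
        rw [← Real.rpow_add hn]; simp
      simp only [w, f]
      linear_combination (-((m : ℝ) + n + 2) ^ (-σ) * a n) * this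
    have hW0 : 0 ≤ ∑ n ∈ Finset.range B, w n := Finset.sum_nonneg fun n _ => hw n
    have hF0 : 0 ≤ ∑ n ∈ Finset.range B, w n * f n ^ p :=
      Finset.sum_nonneg fun n _ => mul_nonneg (hw n) (Real.rpow_nonneg (hf n) _)
    have hS0 : 0 ≤ ∑ n ∈ Finset.range B, w n * f n :=
      Finset.sum_nonneg fun n _ => mul_nonneg (hw n) (hf n)
    have hW : ∑ n ∈ Finset.range B, w n ≤ c₁ * ((m : ℝ) + 1) ^ (1 - σ - δ) := by
      have := h₁ (m + 1) B m.succ_pos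
      push_cast at this
      refine le_trans (Finset.sum_le_sum fun n _ => le_of_eq ?_) this
      simp only [w]; congr 2; ring
    have hH : (∑ n ∈ Finset.range B, w n * f n) ^ p ≤
        (∑ n ∈ Finset.range B, w n) ^ (p - 1) * ∑ n ∈ Finset.range B, w n * f n ^ p := by
      have := Real.rpow_le_rpow hS0
        (Real.inner_le_weight_mul_Lp_of_nonneg (Finset.range B) hp.le w f hw hf) hp0.le
      rwa [Real.mul_rpow (by positivity) (by positivity), ← Real.rpow_mul hW0,
        ← Real.rpow_mul hF0, inv_mul_cancel₀ hp0.ne', Real.rpow_one, sub_mul, one_mul,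
        inv_mul_cancel₀ hp0.ne'] at this
    calc _ ≤ ((m : ℝ) + 1) ^ β * ((c₁ * ((m : ℝ) + 1) ^ (1 - σ - δ)) ^ (p - 1) *
          ∑ n ∈ Finset.range B, w n * f n ^ p) := by
          rw [hS]
          refine mul_le_mul_of_nonneg_left (hH.trans ?_) (by positivity)
          exact mul_le_mul_of_nonneg_right (Real.rpow_le_rpow hW0 hW hp1.le) hF0
      _ = ∑ n ∈ Finset.range B, c₁ ^ (p - 1) * ((m : ℝ) + 1) ^ e * (w n * f n ^ p) := by
          rw [Real.mul_rpow hc₁.le (by positivity), ← Real.rpow_mul hm.le, he,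
            Real.rpow_add hm, ← Finset.mul_sum]
          ring
      _ = _ := by
          refine Finset.sum_congr rfl fun n _ => ?_
          have hn : (0 : ℝ) < (n : ℝ) + 1 := by positivity
          have : ((n : ℝ) + 1) ^ (δ * (p - 1))
              = ((n : ℝ) + 1) ^ (-δ) * ((n : ℝ) + 1) ^ (δ * p) := by
            rw [← Real.rpow_add hn]; congr 1; ring
          simp only [w, f]
          rw [Real.mul_rpow (by positivity) (ha n), ← Real.rpow_mul hn.le, this]
          ring
  refine (Finset.sum_le_sum fun m _ => row m).trans ?_
  rw [Finset.sum_comm, Finset.mul_sum]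
  refine Finset.sum_le_sum fun n _ => ?_
  have hn : (0 : ℝ) < (n : ℝ) + 1 := by positivity
  rw [← Finset.mul_sum]
  have hcol : ∑ m ∈ Finset.range A, ((m : ℝ) + n + 2) ^ (-σ) * ((m : ℝ) + 1) ^ e
      ≤ c₂ * ((n : ℝ) + 1) ^ (1 - σ + e) := by
    have := h₂ (n + 1) A n.succ_pos
    push_cast at this
    rw [sub_neg_eq_add] at this
    refine le_trans (Finset.sum_le_sum fun m _ => le_of_eq ?_) this
    rw [neg_neg]; congr 2; ring
  have ha' : 0 ≤ a n ^ p := Real.rpow_nonneg (ha n) _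
  calc _ ≤ c₁ ^ (p - 1) * (((n : ℝ) + 1) ^ (δ * (p - 1)) * a n ^ p) *
        (c₂ * ((n : ℝ) + 1) ^ (1 - σ + e)) := by gcongr
    _ = c₁ ^ (p - 1) * c₂ *
        ((((n : ℝ) + 1) ^ (δ * (p - 1)) * ((n : ℝ) + 1) ^ (1 - σ + e)) * a n ^ p) := by ring
    _ = _ := by
        rw [← Real.rpow_add hn]
        congr 4
        rw [he]; linear_combination -hσe

/-- A matrix dominated by `(m + n) ^ (-σ)` is bounded between power weighted `ℓ^p` spaces. -/
theorem exists_norm_le_of_kernel_le {p α β σ D : ℝ} (hp : 1 < p) (hα' : α < p - 1)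
    (hβ : -1 < β) (hσ : 0 < σ) (hσe : σ * p = p + β - α) (hD : 0 < D)
    (k : ℕ → ℕ → ℝ) (hk0 : ∀ m n, 0 ≤ k m n)
    (hk : ∀ m n, k m n ≤ D * ((m : ℝ) + n + 2) ^ (-σ)) :
    ∃ C : ℝ, 0 < C ∧ ∀ a : ℕ → ℝ, Summable (fun n : ℕ => ((n : ℝ) + 1) ^ α * |a n| ^ p) →
      (∑' m : ℕ, ((m : ℝ) + 1) ^ β * |∑' n : ℕ, k m n * a n| ^ p) ^ (1 / p)
        ≤ C * (∑' n : ℕ, ((n : ℝ) + 1) ^ α * |a n| ^ p) ^ (1 / p) := by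
  have hp0 : 0 < p := by linarith
  obtain ⟨C, hC, h⟩ := exists_weighted_hilbert_finite hp hα' hβ hσ hσe
  refine ⟨(D ^ p * C) ^ (1 / p), by positivity, fun a ha => ?_⟩
  set S := ∑' n : ℕ, ((n : ℝ) + 1) ^ α * |a n| ^ p with hS
  have hS0 : 0 ≤ S := tsum_nonneg fun n => by positivity
  have hfin : ∀ A B : ℕ, ∑ m ∈ Finset.range A, ((m : ℝ) + 1) ^ β *
      (∑ n ∈ Finset.range B, k m n * |a n|) ^ p ≤ D ^ p * C * S := by
    intro A B
    calc _ ≤ ∑ m ∈ Finset.range A, D ^ p * (((m : ℝ) + 1) ^ β *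
          (∑ n ∈ Finset.range B, ((m : ℝ) + n + 2) ^ (-σ) * |a n|) ^ p) := by
          refine Finset.sum_le_sum fun m _ => ?_
          rw [mul_left_comm, ← Real.mul_rpow hD.le (Finset.sum_nonneg fun n _ => by positivity),
            Finset.mul_sum]
          have h0 : 0 ≤ ∑ n ∈ Finset.range B, k m n * |a n| :=
            Finset.sum_nonneg fun n _ => mul_nonneg (hk0 m n) (abs_nonneg _)
          refine mul_le_mul_of_nonneg_left (Real.rpow_le_rpow h0
            (Finset.sum_le_sum fun n _ => ?_) hp0.le) (by positivity)
          rw [← mul_assoc]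
          exact mul_le_mul_of_nonneg_right (hk m n) (abs_nonneg _)
      _ ≤ D ^ p * (C * ∑ n ∈ Finset.range B, ((n : ℝ) + 1) ^ α * |a n| ^ p) := by
          rw [← Finset.mul_sum]
          exact mul_le_mul_of_nonneg_left (h A B _ fun n => abs_nonneg _) (by positivity)
      _ ≤ D ^ p * (C * S) := by
          gcongr
          exact ha.sum_le_tsum _ fun n _ => by positivity
      _ = _ := by ring
  have hT0 : 0 ≤ D ^ p * C * S := by positivity
  have hsum : ∀ m, Summable fun n => k m n * |a n| := by
    intro m
    refine summable_of_sum_range_le (c := (D ^ p * C * S / ((m : ℝ) + 1) ^ β) ^ (1 / p))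
      (fun n => mul_nonneg (hk0 m n) (abs_nonneg _)) fun B => ?_
    have h0 : ∀ m, 0 ≤ ∑ n ∈ Finset.range B, k m n * |a n| := fun m =>
      Finset.sum_nonneg fun n _ => mul_nonneg (hk0 m n) (abs_nonneg _)
    rw [one_div, Real.le_rpow_inv_iff_of_pos (h0 m) (by positivity) hp0,
      le_div_iff₀ (by positivity), mul_comm]
    refine le_trans ?_ (hfin (m + 1) B)
    exact Finset.single_le_sum (f := fun m : ℕ => ((m : ℝ) + 1) ^ β *
      (∑ n ∈ Finset.range B, k m n * |a n|) ^ p)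
      (fun i _ => mul_nonneg (by positivity) (Real.rpow_nonneg (h0 i) _))
      (Finset.self_mem_range_succ m)
  have hmain : ∑' m : ℕ, ((m : ℝ) + 1) ^ β * |∑' n : ℕ, k m n * a n| ^ p ≤ D ^ p * C * S := by
    refine Real.tsum_le_of_sum_range_le (fun m => by positivity) fun A => ?_
    have hlim : Filter.Tendsto (fun B => ∑ m ∈ Finset.range A, ((m : ℝ) + 1) ^ β *
        (∑ n ∈ Finset.range B, k m n * |a n|) ^ p) Filter.atTop
        (nhds (∑ m ∈ Finset.range A, ((m : ℝ) + 1) ^ β * (∑' n, k m n * |a n|) ^ p)) := by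
      refine tendsto_finsetSum _ fun m _ => ?_
      exact ((hsum m).hasSum.tendsto_sum_nat.rpow_const (Or.inr hp0.le)).const_mul _
    refine le_trans (Finset.sum_le_sum fun m _ => ?_)
      (le_of_tendsto hlim (Filter.Eventually.of_forall fun B => hfin A B))
    have habs : ∀ n, ‖k m n * a n‖ = k m n * |a n| := fun n => by
      rw [Real.norm_eq_abs, abs_mul, abs_of_nonneg (hk0 m n)]
    have : |∑' n, k m n * a n| ≤ ∑' n, k m n * |a n| := by
      have := norm_tsum_le_tsum_norm (f := fun n => k m n * a n) (by simpa only [habs] using hsum m)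
      simpa only [habs, Real.norm_eq_abs] using this
    gcongr
  rw [← Real.mul_rpow (by positivity) hS0]
  exact Real.rpow_le_rpow (tsum_nonneg fun m => by positivity) hmain (by positivity)

theorem summable_rpow_mul_exp_neg (s : ℝ) :
    Summable fun k : ℕ => Real.exp (-(k : ℝ)) * ((k : ℝ) + 1) ^ s := by
  have h := (summable_nat_add_iff 1).2
    (Real.summable_pow_mul_exp_neg_nat_mul ⌈s⌉₊ one_pos)
  refine Summable.of_nonneg_of_le (fun k => by positivity) (fun k => ?_) (h.mul_left (Real.exp 1))
  have h1 : ((k : ℝ) + 1) ^ s ≤ ((k : ℝ) + 1) ^ ⌈s⌉₊ := by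
    rw [← Real.rpow_natCast]
    exact Real.rpow_le_rpow_of_exponent_le (by linarith [(k.cast_nonneg : (0 : ℝ) ≤ k)])
      (Nat.le_ceil s)
  have h2 : Real.exp 1 * (((k + 1 : ℕ) : ℝ) ^ ⌈s⌉₊ * Real.exp (-1 * ((k + 1 : ℕ) : ℝ)))
      = Real.exp (-(k : ℝ)) * ((k : ℝ) + 1) ^ ⌈s⌉₊ := by
    have : Real.exp (-(k : ℝ)) = Real.exp 1 * Real.exp (-1 * ((k + 1 : ℕ) : ℝ)) := by
      rw [← Real.exp_add]; congr 1; push_cast; ring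
    rw [this]; push_cast; ring
  rw [h2]
  exact mul_le_mul_of_nonneg_left h1 (Real.exp_nonneg _)

theorem integrableOn_Ico_of_continuous {μ : Measure ℝ} [IsFiniteMeasure μ] {f : ℝ → ℝ}
    (hf : Continuous f) : IntegrableOn f (Set.Ico 0 1) μ :=
  (hf.continuousOn.integrableOn_compact isCompact_Icc).mono_set Set.Ico_subset_Icc_self

theorem moment_le_of_carleson {μ : Measure ℝ} [IsFiniteMeasure μ] {σ C : ℝ} (hσ : 0 < σ)
    (hC : 0 < C)
    (h : ∀ b : ℝ, 0 ≤ b → b < 1 → (μ (Set.Ico b 1)).toReal ≤ C * (1 - b) ^ σ) :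
    ∃ D : ℝ, 0 < D ∧ ∀ m : ℕ,
      ∫ t in Set.Ico (0 : ℝ) 1, t ^ m ∂μ ≤ D * ((m : ℝ) + 1) ^ (-σ) := by
  have hs := summable_rpow_mul_exp_neg σ
  set S := ∑' k : ℕ, Real.exp (-(k : ℝ)) * ((k : ℝ) + 1) ^ σ with hS
  have hSpos : 0 < S := hs.tsum_pos (fun k => by positivity) 0 (by positivity)
  refine ⟨Real.exp 1 * C * S, by positivity, fun m => ?_⟩
  have hN : (0 : ℝ) < (m : ℝ) + 1 := by positivity
  let b : ℕ → ℝ := fun k => max 0 (1 - ((k : ℝ) + 1) / ((m : ℝ) + 1))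
  have hb0 : ∀ k, 0 ≤ b k := fun k => le_max_left _ _
  have hb1 : ∀ k, b k < 1 := fun k => max_lt one_pos (by
    have : 0 < ((k : ℝ) + 1) / ((m : ℝ) + 1) := by positivity
    linarith)
  let g : ℝ → ℝ := fun t => ∑ k ∈ Finset.range (m + 2),
    (Set.Ico (b k) 1).indicator (fun _ => Real.exp 1 * Real.exp (-(k : ℝ))) t
  have hint : ∀ k, IntegrableOn
      ((Set.Ico (b k) 1).indicator (fun _ => Real.exp 1 * Real.exp (-(k : ℝ))))
      (Set.Ico 0 1) μ := fun k =>
    ((integrable_const _).indicator measurableSet_Ico)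
  have hpt : ∀ t ∈ Set.Ico (0 : ℝ) 1, t ^ m ≤ g t := by
    rintro t ⟨ht0, ht1⟩
    have hx : 0 ≤ (1 - t) * ((m : ℝ) + 1) := mul_nonneg (by linarith) hN.le
    set k := ⌊(1 - t) * ((m : ℝ) + 1)⌋₊ with hk
    have hk1 : (k : ℝ) ≤ (1 - t) * ((m : ℝ) + 1) := Nat.floor_le hx
    have hk2 : (1 - t) * ((m : ℝ) + 1) < k + 1 := Nat.lt_floor_add_one _
    have hkm : k ∈ Finset.range (m + 2) := by
      have : (k : ℝ) ≤ ((m + 1 : ℕ) : ℝ) := by push_cast; nlinarith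
      have : k ≤ m + 1 := by exact_mod_cast this
      exact Finset.mem_range.2 (by omega)
    have htk : t ∈ Set.Ico (b k) 1 := by
      refine ⟨max_le ht0 ?_, ht1⟩
      have : 1 - t ≤ ((k : ℝ) + 1) / ((m : ℝ) + 1) := by
        rw [le_div_iff₀ hN]; exact hk2.le
      linarith
    have hle : t ^ m ≤ Real.exp 1 * Real.exp (-(k : ℝ)) := by
      have h1 : t ≤ Real.exp (-(1 - t)) := by
        have := Real.add_one_le_exp (-(1 - t)); linarith
      calc t ^ m ≤ Real.exp (-(1 - t)) ^ m := pow_le_pow_left₀ ht0 h1 m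
        _ = Real.exp (m * -(1 - t)) := by rw [Real.exp_nat_mul]
        _ ≤ Real.exp (1 + -(k : ℝ)) := Real.exp_le_exp.2 (by nlinarith)
        _ = _ := Real.exp_add _ _
    refine hle.trans ?_
    have := Finset.single_le_sum (f := fun k : ℕ =>
      (Set.Ico (b k) 1).indicator (fun _ => Real.exp 1 * Real.exp (-(k : ℝ))) t)
      (fun i _ => Set.indicator_nonneg (fun _ _ => by positivity) _) hkm
    refine le_trans (le_of_eq ?_) this
    simp only [Set.indicator_of_mem htk]
  calc ∫ t in Set.Ico (0 : ℝ) 1, t ^ m ∂μ ≤ ∫ t in Set.Ico (0 : ℝ) 1, g t ∂μ :=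
        setIntegral_mono_on (integrableOn_Ico_of_continuous (continuous_pow m))
          (integrable_finsetSum _ fun k _ => hint k) measurableSet_Ico hpt
    _ = ∑ k ∈ Finset.range (m + 2), (μ (Set.Ico (b k) 1)).toReal *
          (Real.exp 1 * Real.exp (-(k : ℝ))) := by
        rw [integral_finsetSum _ fun k _ => hint k]
        refine Finset.sum_congr rfl fun k _ => ?_
        rw [setIntegral_indicator measurableSet_Ico,
          Set.inter_eq_self_of_subset_right (Set.Ico_subset_Ico_left (hb0 k))]
        simp [Measure.real]
    _ ≤ ∑ k ∈ Finset.range (m + 2), Real.exp 1 * C * ((m : ℝ) + 1) ^ (-σ) *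
          (Real.exp (-(k : ℝ)) * ((k : ℝ) + 1) ^ σ) := by
        refine Finset.sum_le_sum fun k _ => ?_
        have h1 : (1 - b k) ^ σ ≤ ((k : ℝ) + 1) ^ σ * ((m : ℝ) + 1) ^ (-σ) := by
          rw [Real.rpow_neg hN.le, ← div_eq_mul_inv, ← Real.div_rpow (by positivity) hN.le]
          refine Real.rpow_le_rpow (by linarith [hb1 k]) ?_ hσ.le
          linarith [le_max_right 0 (1 - ((k : ℝ) + 1) / ((m : ℝ) + 1))]
        calc _ ≤ C * (((k : ℝ) + 1) ^ σ * ((m : ℝ) + 1) ^ (-σ)) *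
              (Real.exp 1 * Real.exp (-(k : ℝ))) := by
              refine mul_le_mul_of_nonneg_right ((h _ (hb0 k) (hb1 k)).trans ?_) (by positivity)
              exact mul_le_mul_of_nonneg_left h1 hC.le
          _ = _ := by ring
    _ ≤ Real.exp 1 * C * ((m : ℝ) + 1) ^ (-σ) * S := by
        rw [← Finset.mul_sum]
        refine mul_le_mul_of_nonneg_left ?_ (by positivity)
        exact hs.sum_le_tsum _ fun k _ => by positivity
    _ = _ := by ring

theorem carleson_of_moment_le {μ : Measure ℝ} [IsFiniteMeasure μ] {σ D : ℝ} (hσ : 0 < σ)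
    (hD : 0 < D)
    (h : ∀ m : ℕ, ∫ t in Set.Ico (0 : ℝ) 1, t ^ m ∂μ ≤ D * ((m : ℝ) + 1) ^ (-σ)) :
    ∃ C : ℝ, 0 < C ∧ ∀ b : ℝ, 0 ≤ b → b < 1 →
      (μ (Set.Ico b 1)).toReal ≤ C * (1 - b) ^ σ := by
  refine ⟨2 * D * 2 ^ σ, by positivity, fun b hb0 hb1 => ?_⟩
  have hx : 0 < 1 - b := by linarith
  have hy : 0 < 1 / (2 * (1 - b)) := by positivity
  set m := ⌊1 / (2 * (1 - b))⌋₊ with hm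
  have hm1 : (m : ℝ) ≤ 1 / (2 * (1 - b)) := Nat.floor_le hy.le
  have hm2 : 1 / (2 * (1 - b)) < m + 1 := Nat.lt_floor_add_one _
  have hmb : (m : ℝ) * (1 - b) ≤ 1 / 2 := by
    rw [le_div_iff₀ (by positivity)] at hm1; linarith
  have hlow : ∀ t ∈ Set.Ico b 1, (1 / 2 : ℝ) ≤ t ^ m := by
    rintro t ⟨ht0, ht1⟩
    have h1 := one_add_mul_le_pow (a := t - 1) (by linarith) m
    have h2 : (m : ℝ) * (1 - t) ≤ m * (1 - b) := by gcongr
    have : 1 + (t - 1) = t := by ring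
    rw [this] at h1
    linarith
  have h1 : (μ (Set.Ico b 1)).toReal * (1 / 2) ≤ ∫ t in Set.Ico (0 : ℝ) 1, t ^ m ∂μ := by
    have hi := integrableOn_Ico_of_continuous (μ := μ) (continuous_pow m)
    have hsub : Set.Ico b 1 ⊆ Set.Ico 0 1 := Set.Ico_subset_Ico_left hb0
    calc (μ (Set.Ico b 1)).toReal * (1 / 2) = ∫ t in Set.Ico b 1, (1 / 2 : ℝ) ∂μ := by
          simp [Measure.real]
      _ ≤ ∫ t in Set.Ico b 1, t ^ m ∂μ :=
          setIntegral_mono_on (integrable_const _) (hi.mono_set hsub) measurableSet_Ico hlow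
      _ ≤ _ := by
          refine setIntegral_mono_set hi ?_ hsub.eventuallyLE
          exact (ae_restrict_mem measurableSet_Ico).mono fun t ht => pow_nonneg ht.1 m
  have h2 : ((m : ℝ) + 1) ^ (-σ) ≤ 2 ^ σ * (1 - b) ^ σ := by
    calc _ ≤ (1 / (2 * (1 - b))) ^ (-σ) :=
          Real.rpow_le_rpow_of_nonpos hy hm2.le (by linarith)
      _ = _ := by
          rw [one_div, Real.inv_rpow (by positivity), Real.rpow_neg (by positivity), inv_inv,
            Real.mul_rpow two_pos.le hx.le]
  have h3 := mul_le_mul_of_nonneg_left h2 hD.le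
  linarith [h m]

theorem succ_mul_pow_mul_one_sub_le {t : ℝ} (ht0 : 0 ≤ t) (ht1 : t ≤ 1) (m : ℕ) :
    ((m : ℝ) + 1) * (t ^ m * (1 - t)) ≤ 1 := by
  have h1 : ((m : ℝ) + 1) * t ^ m ≤ ∑ k ∈ Finset.range (m + 1), t ^ k := by
    have : ∑ k ∈ Finset.range (m + 1), t ^ m = ((m : ℝ) + 1) * t ^ m := by simp
    rw [← this]
    exact Finset.sum_le_sum fun k hk =>
      pow_le_pow_of_le_one ht0 ht1 (Nat.lt_succ_iff.1 (Finset.mem_range.1 hk))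
  have h2 := mul_neg_geom_sum t (m + 1)
  have h3 := mul_le_mul_of_nonneg_right h1 (sub_nonneg.2 ht1)
  have h4 : 0 ≤ t ^ (m + 1) := by positivity
  linarith

/-- The generating function of the sequence equal to `1` on `[0, N)` and `-1` on `[N, 2N)`. -/
noncomputable def stepPoly (N : ℕ) (t : ℝ) : ℝ := (1 - t ^ N) * ∑ n ∈ Finset.range N, t ^ n

/-- The sequence equal to `1` on `[0, N)`, `-1` on `[N, 2N)` and `0` elsewhere. -/
noncomputable def stepSeq (N n : ℕ) : ℝ := if n < N then 1 else if n < N + N then -1 else 0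

theorem continuous_stepPoly (N : ℕ) : Continuous (stepPoly N) := by
  unfold stepPoly; fun_prop

theorem stepPoly_nonneg {N : ℕ} {t : ℝ} (ht0 : 0 ≤ t) (ht1 : t ≤ 1) : 0 ≤ stepPoly N t :=
  mul_nonneg (sub_nonneg.2 (pow_le_one₀ ht0 ht1)) (Finset.sum_nonneg fun _ _ => by positivity)

theorem stepPoly_le {N : ℕ} {t : ℝ} (ht0 : 0 ≤ t) (ht1 : t ≤ 1) :
    stepPoly N t ≤ (N : ℝ) ^ 2 * (1 - t) := by
  have h0 : 0 ≤ ∑ n ∈ Finset.range N, t ^ n := Finset.sum_nonneg fun _ _ => by positivity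
  have h1 : ∑ n ∈ Finset.range N, t ^ n ≤ N := by
    refine (Finset.sum_le_sum fun n _ => pow_le_one₀ ht0 ht1).trans ?_
    simp
  have h2 := mul_neg_geom_sum t N
  have h3 : 0 ≤ 1 - t := sub_nonneg.2 ht1
  rw [stepPoly, ← h2]
  calc (1 - t) * (∑ n ∈ Finset.range N, t ^ n) * ∑ n ∈ Finset.range N, t ^ n
      ≤ (1 - t) * N * N := by gcongr
    _ = _ := by ring

theorem le_stepPoly {N : ℕ} (hN : 0 < N) {t : ℝ} (ht0 : 1 - 1 / (2 * (N : ℝ)) ≤ t)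
    (ht1 : t ≤ 1 - 1 / (4 * (N : ℝ))) {m : ℕ} (hm : m < N) :
    (N : ℝ) / 20 ≤ t ^ (m + 1) * stepPoly N t := by
  have hN' : (0 : ℝ) < N := by exact_mod_cast hN
  have hN1 : (1 : ℝ) ≤ N := by exact_mod_cast hN
  have hq : 1 / (2 * (N : ℝ)) ≤ 1 / 2 := by
    rw [div_le_div_iff₀ (by positivity) two_pos]; linarith
  have hq4 : 0 < 1 / (4 * (N : ℝ)) := by positivity
  have ht : 0 ≤ t := by linarith
  have ht1' : t ≤ 1 := by linarith
  have hpowN : 1 / 2 ≤ t ^ N := by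
    have h1 := one_add_mul_le_pow (a := t - 1) (by linarith) N
    have h2 : (N : ℝ) * (1 - t) ≤ N * (1 / (2 * (N : ℝ))) :=
      mul_le_mul_of_nonneg_left (by linarith) hN'.le
    have h3 : (N : ℝ) * (1 / (2 * (N : ℝ))) = 1 / 2 := by field_simp
    have : 1 + (t - 1) = t := by ring
    rw [this] at h1
    linarith
  have hpow : ∀ n ≤ N, 1 / 2 ≤ t ^ n := fun n hn =>
    hpowN.trans (pow_le_pow_of_le_one ht ht1' hn)
  have hupper : t ^ N ≤ 4 / 5 := by
    have hx : t * (1 + 1 / (4 * (N : ℝ))) ≤ 1 := by nlinarith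
    have h1 := one_add_mul_le_pow (a := 1 / (4 * (N : ℝ))) (by linarith) N
    have h2 : (N : ℝ) * (1 / (4 * (N : ℝ))) = 1 / 4 := by field_simp
    rw [h2] at h1
    have h3 : t ^ N * (1 + 1 / (4 * (N : ℝ))) ^ N ≤ 1 := by
      rw [← mul_pow]; exact pow_le_one₀ (by positivity) hx
    have h4 : 0 ≤ t ^ N := by positivity
    nlinarith
  have hsum : (N : ℝ) / 2 ≤ ∑ n ∈ Finset.range N, t ^ n := by
    have : ∑ n ∈ Finset.range N, (1 / 2 : ℝ) = N / 2 := by simp; ring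
    rw [← this]
    exact Finset.sum_le_sum fun n hn => hpow n (Finset.mem_range.1 hn).le
  calc (N : ℝ) / 20 = 1 / 2 * (1 / 5 * (N / 2)) := by ring
    _ ≤ _ := by
      unfold stepPoly
      refine mul_le_mul (hpow _ hm) (mul_le_mul (by linarith) hsum (by positivity) (by linarith))
        (by positivity) (by positivity)

theorem tsum_moment_mul_stepSeq {μ : Measure ℝ} [IsFiniteMeasure μ] (N m : ℕ) :
    ∑' n : ℕ, (∫ t in Set.Ico (0 : ℝ) 1, t ^ (m + n + 1) ∂μ) * stepSeq N n
      = ∫ t in Set.Ico (0 : ℝ) 1, t ^ (m + 1) * stepPoly N t ∂μ := by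
  rw [tsum_eq_sum (s := Finset.range (N + N))]
  · have hcong : ∀ n, (∫ t in Set.Ico (0 : ℝ) 1, t ^ (m + n + 1) ∂μ) * stepSeq N n
        = ∫ t in Set.Ico (0 : ℝ) 1, t ^ (m + n + 1) * stepSeq N n ∂μ := fun n =>
      (integral_mul_const _ _).symm
    simp_rw [hcong]
    rw [← integral_finsetSum _ fun n _ =>
      integrableOn_Ico_of_continuous (by fun_prop)]
    congr 1
    ext t
    rw [Finset.sum_range_add, stepPoly, sub_mul, one_mul, mul_sub, Finset.mul_sum, Finset.mul_sum,
      Finset.mul_sum, sub_eq_add_neg, ← Finset.sum_neg_distrib]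
    congr 1
    · refine Finset.sum_congr rfl fun n hn => ?_
      rw [stepSeq, if_pos (Finset.mem_range.1 hn)]
      ring
    · refine Finset.sum_congr rfl fun n hn => ?_
      rw [stepSeq, if_neg (by omega), if_pos (by have := Finset.mem_range.1 hn; omega)]
      ring
  · intro n hn
    have : N + N ≤ n := by simpa using hn
    rw [stepSeq, if_neg (by omega), if_neg (by omega), mul_zero]

theorem abs_stepSeq_rpow {p : ℝ} (hp : 0 < p) (N n : ℕ) :
    |stepSeq N n| ^ p = if n < N + N then 1 else 0 := by
  unfold stepSeq
  split_ifs <;> first | omega | simp [Real.zero_rpow hp.ne']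

theorem le_of_geometric_increment {u : ℕ → ℝ} {D r : ℝ} (hr0 : 0 < r) (hr1 : r < 1)
    (hu : Filter.Tendsto u Filter.atTop (nhds 0)) (h : ∀ j, u j ≤ D * r ^ j + u (j + 1)) (j : ℕ) :
    u j ≤ D / (1 - r) * r ^ j := by
  have h1 : 0 < 1 - r := by linarith
  have hmono : Monotone fun j => u j - D / (1 - r) * r ^ j := by
    refine monotone_nat_of_le_succ fun j => ?_
    have e : D / (1 - r) * r ^ j - D / (1 - r) * r ^ (j + 1) = D * r ^ j := by
      field_simp; ring
    linarith [h j]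
  have hlim : Filter.Tendsto (fun j => u j - D / (1 - r) * r ^ j) Filter.atTop (nhds 0) := by
    simpa using hu.sub ((tendsto_pow_atTop_nhds_zero_of_lt_one hr0.le hr1).const_mul (D / (1 - r)))
  have := hmono.ge_of_tendsto hlim j
  linarith

/-- Carleson condition from its version on dyadic pieces of `[0, 1)`. -/
theorem carleson_of_dyadic {μ : Measure ℝ} [IsFiniteMeasure μ] {σ D : ℝ} (hσ : 0 < σ)
    (hD : 0 < D)
    (h : ∀ j : ℕ, (μ (Set.Ico (1 - (1 / 2 : ℝ) ^ (j + 1)) (1 - (1 / 2 : ℝ) ^ (j + 2)))).toReal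
      ≤ D * ((1 / 2 : ℝ) ^ j) ^ σ) :
    ∃ C : ℝ, 0 < C ∧ ∀ b : ℝ, 0 ≤ b → b < 1 →
      (μ (Set.Ico b 1)).toReal ≤ C * (1 - b) ^ σ := by
  set r : ℝ := (1 / 2 : ℝ) ^ σ with hr
  have hr0 : 0 < r := by positivity
  have hr1 : r < 1 := Real.rpow_lt_one (by norm_num) (by norm_num) hσ
  have hrj : ∀ j : ℕ, ((1 / 2 : ℝ) ^ j) ^ σ = r ^ j := fun j => by
    rw [hr, ← Real.rpow_natCast, ← Real.rpow_natCast, ← Real.rpow_mul (by norm_num),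
      ← Real.rpow_mul (by norm_num), mul_comm]
  let u : ℕ → ℝ := fun j => (μ (Set.Ico (1 - (1 / 2 : ℝ) ^ (j + 1)) 1)).toReal
  have hu : Filter.Tendsto u Filter.atTop (nhds 0) := by
    have hanti : Antitone fun j : ℕ => Set.Ico (1 - (1 / 2 : ℝ) ^ (j + 1)) 1 := by
      intro i j hij
      refine Set.Ico_subset_Ico_left ?_
      have : (1 / 2 : ℝ) ^ (j + 1) ≤ (1 / 2) ^ (i + 1) :=
        pow_le_pow_of_le_one (by norm_num) (by norm_num) (by omega)
      linarith
    have hempty : ⋂ j : ℕ, Set.Ico (1 - (1 / 2 : ℝ) ^ (j + 1)) 1 = ∅ := by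
      refine Set.eq_empty_iff_forall_notMem.2 fun t ht => ?_
      rw [Set.mem_iInter] at ht
      have ht1 : t < 1 := (ht 0).2
      obtain ⟨n, hn⟩ := exists_pow_lt_of_lt_one (sub_pos.2 ht1) (by norm_num : (1 / 2 : ℝ) < 1)
      have h1 := (ht n).1
      have h2 : (1 / 2 : ℝ) ^ (n + 1) ≤ (1 / 2) ^ n :=
        pow_le_pow_of_le_one (by norm_num) (by norm_num) (by omega)
      linarith
    have := tendsto_measure_iInter_atTop (μ := μ)
      (fun j : ℕ => measurableSet_Ico.nullMeasurableSet) hanti ⟨0, measure_ne_top _ _⟩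
    rw [hempty, measure_empty] at this
    exact (ENNReal.tendsto_toReal ENNReal.zero_ne_top).comp this
  have hstep : ∀ j, u j ≤ D * r ^ j + u (j + 1) := by
    intro j
    have hsub : Set.Ico (1 - (1 / 2 : ℝ) ^ (j + 1)) 1 ⊆
        Set.Ico (1 - (1 / 2 : ℝ) ^ (j + 1)) (1 - (1 / 2 : ℝ) ^ (j + 2)) ∪
          Set.Ico (1 - (1 / 2 : ℝ) ^ (j + 1 + 1)) 1 := Set.Ico_subset_Ico_union_Ico
    have h1 := (measureReal_mono (μ := μ) hsub).trans (measureReal_union_le _ _)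
    have h2 := h j
    rw [hrj] at h2
    simp only [Measure.real] at h1
    exact h1.trans (by gcongr)
  have hfin := le_of_geometric_increment hr0 hr1 hu hstep
  set E := D / (1 - r) with hE
  have hE0 : 0 < E := div_pos hD (by linarith)
  set V := (μ Set.univ).toReal with hV
  have hV0 : 0 ≤ V := ENNReal.toReal_nonneg
  refine ⟨(E / r + V) / r, by positivity, fun b hb0 hb1 => ?_⟩
  obtain ⟨n, hn1, hn2⟩ := exists_nat_pow_near_of_lt_one (sub_pos.2 hb1) (by linarith : 1 - b ≤ 1)
    (by norm_num : (0 : ℝ) < 1 / 2) (by norm_num)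
  have hlow : r ^ (n + 1) ≤ (1 - b) ^ σ := by
    rw [← hrj]
    exact Real.rpow_le_rpow (by positivity) hn1.le hσ.le
  have hmain : (μ (Set.Ico b 1)).toReal ≤ (E / r + V) * r ^ n := by
    rcases n with _ | j
    · have : (μ (Set.Ico b 1)).toReal ≤ V := measureReal_mono (Set.subset_univ _)
      have : 0 ≤ E / r := by positivity
      simp only [pow_zero, mul_one]
      linarith
    · have h1 : (μ (Set.Ico b 1)).toReal ≤ u j :=
        measureReal_mono (Set.Ico_subset_Ico_left (by linarith))
      have h2 : (E / r + V) * r ^ (j + 1) = E * r ^ j + V * r ^ (j + 1) := by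
        field_simp; ring
      have h3 : 0 ≤ V * r ^ (j + 1) := by positivity
      linarith [hfin j]
  calc _ ≤ (E / r + V) * r ^ n := hmain
    _ = (E / r + V) / r * r ^ (n + 1) := by field_simp; ring
    _ ≤ _ := by gcongr

theorem carleson_of_bounded {p α β σ C : ℝ} (hp : 1 < p) (hα : -1 < α) (hβ : -1 < β)
    (hβ' : β < p - 1) (hσ : 0 < σ) (hσe : σ * p = p + β - α) (hC : 0 < C)
    {μ : Measure ℝ} [IsFiniteMeasure μ]
    (h : ∀ a : ℕ → ℝ, Summable (fun n : ℕ => ((n : ℝ) + 1) ^ α * |a n| ^ p) →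
      (∑' m : ℕ, ((m : ℝ) + 1) ^ β *
          |∑' n : ℕ, (∫ t in Set.Ico (0 : ℝ) 1, t ^ (m + n + 1) ∂μ) * a n| ^ p) ^ (1 / p)
        ≤ C * (∑' n : ℕ, ((n : ℝ) + 1) ^ α * |a n| ^ p) ^ (1 / p)) :
    ∃ C : ℝ, 0 < C ∧ ∀ b : ℝ, 0 ≤ b → b < 1 →
      (μ (Set.Ico b 1)).toReal ≤ C * (1 - b) ^ σ := by
  have hp0 : 0 < p := by linarith
  obtain ⟨K, hK, hKs⟩ := exists_sum_rpow_le hα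
  obtain ⟨κ, hκ, hκs⟩ := exists_le_sum_rpow hβ
  set V := μ.real (Set.Ico 0 1) with hV
  have hV0 : 0 ≤ V := measureReal_nonneg
  let I : ℕ → ℕ → ℝ := fun N m => ∫ t in Set.Ico (0 : ℝ) 1, t ^ (m + 1) * stepPoly N t ∂μ
  have hII : ∀ N m, IntegrableOn (fun t : ℝ => t ^ (m + 1) * stepPoly N t) (Set.Ico 0 1) μ :=
    fun N m => integrableOn_Ico_of_continuous
      ((continuous_pow _).mul (continuous_stepPoly N))
  have hI0 : ∀ N m, 0 ≤ I N m := fun N m =>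
    setIntegral_nonneg measurableSet_Ico fun t ht =>
      mul_nonneg (pow_nonneg ht.1 _) (stepPoly_nonneg ht.1 ht.2.le)
  have hIupper : ∀ N m, I N m ≤ (N : ℝ) ^ 2 * V * ((m : ℝ) + 1)⁻¹ := by
    intro N m
    have hm : (0 : ℝ) < (m : ℝ) + 1 := by positivity
    have hpt : ∀ t ∈ Set.Ico (0 : ℝ) 1,
        t ^ (m + 1) * stepPoly N t ≤ (N : ℝ) ^ 2 * ((m : ℝ) + 1)⁻¹ := by
      rintro t ⟨ht0, ht1⟩
      have h1 : t ^ m * (1 - t) ≤ ((m : ℝ) + 1)⁻¹ := by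
        rw [← one_div, le_div_iff₀ hm, mul_comm]
        exact succ_mul_pow_mul_one_sub_le ht0 ht1.le m
      calc t ^ (m + 1) * stepPoly N t ≤ t ^ m * ((N : ℝ) ^ 2 * (1 - t)) :=
            mul_le_mul (pow_le_pow_of_le_one ht0 ht1.le m.le_succ) (stepPoly_le ht0 ht1.le)
              (stepPoly_nonneg ht0 ht1.le) (by positivity)
        _ = (N : ℝ) ^ 2 * (t ^ m * (1 - t)) := by ring
        _ ≤ _ := by gcongr
    refine (setIntegral_mono_on (hII N m) (integrable_const _) measurableSet_Ico hpt).trans ?_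
    rw [setIntegral_const, smul_eq_mul]
    exact le_of_eq (by ring)
  have hsumm : ∀ N, Summable fun m : ℕ => ((m : ℝ) + 1) ^ β * I N m ^ p := by
    intro N
    have hs : Summable fun m : ℕ => ((m : ℝ) + 1) ^ (β - p) := by
      have := (summable_nat_add_iff 1).2 (Real.summable_nat_rpow.2 (by linarith : β - p < -1))
      simpa using this
    refine Summable.of_nonneg_of_le
      (fun m => mul_nonneg (by positivity) (Real.rpow_nonneg (hI0 N m) _)) (fun m => ?_)
      (hs.mul_left (((N : ℝ) ^ 2 * V) ^ p))
    have hm : (0 : ℝ) < (m : ℝ) + 1 := by positivity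
    calc ((m : ℝ) + 1) ^ β * I N m ^ p
        ≤ ((m : ℝ) + 1) ^ β * ((N : ℝ) ^ 2 * V * ((m : ℝ) + 1)⁻¹) ^ p :=
          mul_le_mul_of_nonneg_left
            (Real.rpow_le_rpow (hI0 N m) (hIupper N m) hp0.le) (by positivity)
      _ = _ := by
          rw [Real.mul_rpow (by positivity) (by positivity), Real.inv_rpow hm.le,
            Real.rpow_sub hm]
          ring
  have hIlower : ∀ N m : ℕ, 0 < N → m < N → (N : ℝ) / 20 *
      μ.real (Set.Ico (1 - 1 / (2 * (N : ℝ))) (1 - 1 / (4 * (N : ℝ)))) ≤ I N m := by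
    intro N m hN hm
    have hN1 : (1 : ℝ) ≤ N := by exact_mod_cast hN
    have hq : 1 / (2 * (N : ℝ)) ≤ 1 := by
      rw [div_le_one (by positivity)]; linarith
    have hq4 : 0 < 1 / (4 * (N : ℝ)) := by positivity
    have hsub : Set.Ico (1 - 1 / (2 * (N : ℝ))) (1 - 1 / (4 * (N : ℝ))) ⊆ Set.Ico 0 1 :=
      Set.Ico_subset_Ico (by linarith) (by linarith)
    calc _ = ∫ t in Set.Ico (1 - 1 / (2 * (N : ℝ))) (1 - 1 / (4 * (N : ℝ))), (N : ℝ) / 20 ∂μ := by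
          rw [setIntegral_const, smul_eq_mul, mul_comm]
      _ ≤ ∫ t in Set.Ico (1 - 1 / (2 * (N : ℝ))) (1 - 1 / (4 * (N : ℝ))),
            t ^ (m + 1) * stepPoly N t ∂μ :=
          setIntegral_mono_on (integrable_const _) ((hII N m).mono_set hsub) measurableSet_Ico
            fun t ht => le_stepPoly hN ht.1 ht.2.le hm
      _ ≤ _ := by
          refine setIntegral_mono_set (hII N m) ?_ hsub.eventuallyLE
          exact (ae_restrict_mem measurableSet_Ico).mono fun t ht =>
            mul_nonneg (pow_nonneg ht.1 _) (stepPoly_nonneg ht.1 ht.2.le)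
  set E : ℝ := κ⁻¹ * 20 ^ p * (C ^ p * (K * 2 ^ (α + 1))) with hE
  have hE0 : 0 < E := by positivity
  have hpiece : ∀ N : ℕ, 0 < N →
      μ.real (Set.Ico (1 - 1 / (2 * (N : ℝ))) (1 - 1 / (4 * (N : ℝ))))
        ≤ E ^ (1 / p) * (N : ℝ) ^ (-σ) := by
    intro N hN
    have hN' : (0 : ℝ) < N := by exact_mod_cast hN
    set F := μ.real (Set.Ico (1 - 1 / (2 * (N : ℝ))) (1 - 1 / (4 * (N : ℝ)))) with hF
    have hF0 : 0 ≤ F := measureReal_nonneg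
    have hzero : ∀ n ∉ Finset.range (N + N), ((n : ℝ) + 1) ^ α * |stepSeq N n| ^ p = 0 := by
      intro n hn
      rw [abs_stepSeq_rpow hp0, if_neg (by simpa using hn), mul_zero]
    have hb := h (stepSeq N) (summable_of_ne_finset_zero hzero)
    have hnorm : ∑' n : ℕ, ((n : ℝ) + 1) ^ α * |stepSeq N n| ^ p
        ≤ K * (2 * (N : ℝ)) ^ (α + 1) := by
      rw [tsum_eq_sum hzero]
      have := hKs (N + N)
      rw [Nat.cast_add, ← two_mul (N : ℝ)] at this
      refine le_trans (Finset.sum_le_sum fun n hn => le_of_eq ?_) this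
      rw [abs_stepSeq_rpow hp0, if_pos (Finset.mem_range.1 hn), mul_one]
    have hIe : ∀ m : ℕ, ((m : ℝ) + 1) ^ β *
        |∑' n : ℕ, (∫ t in Set.Ico (0 : ℝ) 1, t ^ (m + n + 1) ∂μ) * stepSeq N n| ^ p
          = ((m : ℝ) + 1) ^ β * I N m ^ p := fun m => by
      rw [tsum_moment_mul_stepSeq, abs_of_nonneg (hI0 N m)]
    simp_rw [hIe] at hb
    set T := ∑' m : ℕ, ((m : ℝ) + 1) ^ β * I N m ^ p with hT
    have hT0 : 0 ≤ T := tsum_nonneg fun m =>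
      mul_nonneg (by positivity) (Real.rpow_nonneg (hI0 N m) _)
    set S := ∑' n : ℕ, ((n : ℝ) + 1) ^ α * |stepSeq N n| ^ p with hS
    have hS0 : 0 ≤ S := tsum_nonneg fun n => by positivity
    have hTS : T ≤ C ^ p * S := by
      have := Real.rpow_le_rpow (by positivity) hb hp0.le
      rwa [Real.mul_rpow hC.le (by positivity), ← Real.rpow_mul hT0, ← Real.rpow_mul hS0,
        one_div, inv_mul_cancel₀ hp0.ne', Real.rpow_one, Real.rpow_one] at this
    have hTl : κ * (N : ℝ) ^ (β + 1) * ((N : ℝ) / 20 * F) ^ p ≤ T := by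
      calc _ ≤ (∑ m ∈ Finset.range N, ((m : ℝ) + 1) ^ β) * ((N : ℝ) / 20 * F) ^ p := by
            gcongr; exact hκs N
        _ ≤ ∑ m ∈ Finset.range N, ((m : ℝ) + 1) ^ β * I N m ^ p := by
            rw [Finset.sum_mul]
            refine Finset.sum_le_sum fun m hm => ?_
            refine mul_le_mul_of_nonneg_left ?_ (by positivity)
            exact Real.rpow_le_rpow (by positivity)
              (hIlower N m hN (Finset.mem_range.1 hm)) hp0.le
        _ ≤ T := (hsumm N).sum_le_tsum _ fun m _ =>
            mul_nonneg (by positivity) (Real.rpow_nonneg (hI0 N m) _)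
    have hall : κ * (N : ℝ) ^ (β + 1) * ((N : ℝ) / 20 * F) ^ p
        ≤ C ^ p * (K * (2 * (N : ℝ)) ^ (α + 1)) :=
      hTl.trans (hTS.trans (by gcongr))
    have hFp : F ^ p ≤ E * ((N : ℝ) ^ (-σ)) ^ p := by
      rw [Real.mul_rpow (by positivity) hF0, Real.div_rpow hN'.le (by norm_num),
        Real.mul_rpow two_pos.le hN'.le] at hall
      have hexp : (N : ℝ) ^ (α + 1) = (N : ℝ) ^ (β + 1) * (N : ℝ) ^ p * ((N : ℝ) ^ (-σ)) ^ p := by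
        rw [← Real.rpow_mul hN'.le, ← Real.rpow_add hN', ← Real.rpow_add hN']
        congr 1; linear_combination hσe
      rw [hexp] at hall
      have hX : 0 < κ * (20 ^ p)⁻¹ * ((N : ℝ) ^ (β + 1) * (N : ℝ) ^ p) := by positivity
      refine le_of_mul_le_mul_left ?_ hX
      calc _ = κ * (N : ℝ) ^ (β + 1) * ((N : ℝ) ^ p / 20 ^ p * F ^ p) := by ring
        _ ≤ _ := hall
        _ = _ := by rw [hE]; field_simp
    have := Real.rpow_le_rpow (by positivity) hFp (by positivity : 0 ≤ 1 / p)
    rwa [Real.mul_rpow hE0.le (by positivity), ← Real.rpow_mul hF0,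
      ← Real.rpow_mul (x := (N : ℝ) ^ (-σ)) (by positivity), mul_one_div_cancel hp0.ne',
      Real.rpow_one, Real.rpow_one] at this
  refine carleson_of_dyadic hσ (D := E ^ (1 / p)) (by positivity) fun j => ?_
  have := hpiece (2 ^ j) (by positivity)
  have e1 : 1 / (2 * ((2 ^ j : ℕ) : ℝ)) = (1 / 2 : ℝ) ^ (j + 1) := by
    push_cast; rw [one_div_pow, pow_succ']
  have e2 : 1 / (4 * ((2 ^ j : ℕ) : ℝ)) = (1 / 2 : ℝ) ^ (j + 2) := by
    push_cast; rw [one_div_pow, pow_add]; ring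
  have e3 : ((2 ^ j : ℕ) : ℝ) ^ (-σ) = ((1 / 2 : ℝ) ^ j) ^ σ := by
    push_cast
    rw [one_div_pow, one_div, Real.inv_rpow (by positivity), Real.rpow_neg (by positivity)]
  rwa [e1, e2, e3] at this

theorem stmt_7 (p α β : ℝ) (hp : 1 < p)
    (hα : -1 < α) (hα' : α < p - 1) (hβ : -1 < β) (hβ' : β < p - 1)
    (μ : Measure ℝ) [IsFiniteMeasure μ] :
    ((∃ C' : ℝ, 0 < C' ∧ ∀ a : ℕ → ℝ,
        Summable (fun n : ℕ => ((n : ℝ) + 1) ^ α * |a n| ^ p) →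
        (∑' m : ℕ, ((m : ℝ) + 1) ^ β *
            |∑' n : ℕ, (∫ t in Set.Ico (0:ℝ) 1, t ^ (m + n + 1) ∂μ) * a n| ^ p) ^ (1/p)
          ≤ C' * (∑' n : ℕ, ((n : ℝ) + 1) ^ α * |a n| ^ p) ^ (1/p))
      ↔ (∃ C : ℝ, 0 < C ∧ ∀ b : ℝ, 0 ≤ b → b < 1 →
          (μ (Set.Ico b 1)).toReal ≤ C * (1 - b) ^ (1 + (β - α)/p)))
    ∧
    ((∃ C : ℝ, 0 < C ∧ ∀ b : ℝ, 0 ≤ b → b < 1 →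
          (μ (Set.Ico b 1)).toReal ≤ C * (1 - b) ^ (1 + (β - α)/p))
      ↔ (∃ C'' : ℝ, 0 < C'' ∧ ∀ n : ℕ, 1 ≤ n →
          ∫ t in Set.Ico (0:ℝ) 1, t ^ (n - 1) ∂μ ≤ C'' * (n : ℝ) ^ (-1 - (β - α)/p))) := by
  have hp0 : 0 < p := by linarith
  have hσ : 0 < 1 + (β - α) / p := by
    have : -1 < (β - α) / p := by rw [lt_div_iff₀ hp0]; linarith
    linarith
  have hσe : (1 + (β - α) / p) * p = p + β - α := by field_simp; ring
  have hneg : -1 - (β - α) / p = -(1 + (β - α) / p) := by ring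
  refine ⟨⟨fun ⟨C, hC, h⟩ => carleson_of_bounded hp hα hβ hβ' hσ hσe hC h,
    fun ⟨C, hC, h⟩ => ?_⟩, fun ⟨C, hC, h⟩ => ?_, fun ⟨D, hD, h⟩ => ?_⟩
  · obtain ⟨D, hD, hm⟩ := moment_le_of_carleson hσ hC h
    refine exists_norm_le_of_kernel_le hp hα' hβ hσ hσe hD
      (fun m n => ∫ t in Set.Ico (0 : ℝ) 1, t ^ (m + n + 1) ∂μ) (fun m n => ?_) fun m n => ?_
    · exact setIntegral_nonneg measurableSet_Ico fun t ht => pow_nonneg ht.1 _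
    · refine (hm (m + n + 1)).trans (le_of_eq ?_)
      push_cast; congr 2; ring
  · obtain ⟨D, hD, hm⟩ := moment_le_of_carleson hσ hC h
    refine ⟨D, hD, fun n hn => ?_⟩
    have := hm (n - 1)
    rwa [Nat.cast_sub hn, Nat.cast_one, sub_add_cancel, ← hneg] at this
  · refine carleson_of_moment_le hσ hD fun m => ?_
    have := h (m + 1) m.succ_pos
    rwa [Nat.add_sub_cancel, Nat.cast_add, Nat.cast_one, hneg] at this
end

section
/- Let p > 1 and -1 < α < p-1, and let g: [0,1) → ℝ be non-negative, non-decreasing and bounded with ‖g‖_∞ > 0. Then for every non-negative sequence a ∈ l^p_α, the generalized Hilbert inequality holds: (∑_{m=1}^∞ m^α (∑_{n=1}^∞ a_n ∫_0^1 t^{m+n-1} g(t) dt)^p)^{1/p} ≤ ‖g‖_∞ · π csc(π(1+α)/p) · (∑_{n=1}^∞ n^α a_n^p)^{1/p}. -/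
open MeasureTheory Real

/-- The Schur test for a weighted `ℓ^p` inequality with an infinite non-negative matrix. -/
theorem ENNReal.tsum_mul_tsum_rpow_le_of_schur {p q : ℝ} (hpq : p.HolderConjugate q)
    (K : ℕ → ℕ → ENNReal) (h U V W a : ℕ → ENNReal) (C : ENNReal)
    (hh0 : ∀ n, h n ≠ 0) (hh : ∀ n, h n ≠ ⊤)
    (h1 : ∀ m, ∑' n, K m n * (h n)⁻¹ ^ q ≤ C * U m)
    (h2 : ∀ n, ∑' m, W m * U m ^ (p - 1) * K m n * h n ^ p ≤ C * V n) :
    ∑' m, W m * (∑' n, K m n * a n) ^ p ≤ C ^ p * ∑' n, V n * a n ^ p := by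
  have hp : 0 < p := hpq.pos
  have hq : 0 < q := hpq.symm.pos
  have hp1 : 0 ≤ p - 1 := hpq.sub_one_pos.le
  have key (m : ℕ) : (∑' n, K m n * a n) ^ p ≤
      (∑' n, K m n * h n ^ p * a n ^ p) * (C * U m) ^ (p - 1) := by
    have hol := ENNReal.lintegral_mul_le_Lp_mul_Lq Measure.count hpq
      (f := fun n : ℕ => K m n ^ (1 / p) * (h n * a n))
      (g := fun n : ℕ => K m n ^ (1 / q) * (h n)⁻¹)
      measurable_from_top.aemeasurable measurable_from_top.aemeasurable
    simp only [lintegral_count, Pi.mul_apply] at hol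
    have e1 (n : ℕ) : K m n ^ (1 / p) * (h n * a n) * (K m n ^ (1 / q) * (h n)⁻¹)
        = K m n * a n := by
      have : K m n ^ (1 / p) * K m n ^ (1 / q) = K m n := by
        rw [← ENNReal.rpow_add_of_nonneg _ _ (by positivity) (by positivity), one_div, one_div,
          hpq.inv_add_inv_eq_one, ENNReal.rpow_one]
      calc _ = (K m n ^ (1 / p) * K m n ^ (1 / q)) * a n * (h n * (h n)⁻¹) := by ring
        _ = _ := by rw [this, ENNReal.mul_inv_cancel (hh0 n) (hh n), mul_one]
    have e2 (n : ℕ) : (K m n ^ (1 / p) * (h n * a n)) ^ p = K m n * h n ^ p * a n ^ p := by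
      rw [ENNReal.mul_rpow_of_nonneg _ _ hp.le, ENNReal.mul_rpow_of_nonneg _ _ hp.le,
        ← ENNReal.rpow_mul, one_div_mul_cancel hp.ne', ENNReal.rpow_one, mul_assoc]
    have e3 (n : ℕ) : (K m n ^ (1 / q) * (h n)⁻¹) ^ q = K m n * (h n)⁻¹ ^ q := by
      rw [ENNReal.mul_rpow_of_nonneg _ _ hq.le,
        ← ENNReal.rpow_mul, one_div_mul_cancel hq.ne', ENNReal.rpow_one]
    simp only [e1, e2, e3] at hol
    have hexp : 1 / q * p = p - 1 := by
      have := hpq.inv_add_inv_eq_one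
      field_simp at this ⊢
      linarith
    calc (∑' n, K m n * a n) ^ p
        ≤ ((∑' n, K m n * h n ^ p * a n ^ p) ^ (1 / p)
            * (∑' n, K m n * (h n)⁻¹ ^ q) ^ (1 / q)) ^ p := by gcongr
      _ = (∑' n, K m n * h n ^ p * a n ^ p) * (∑' n, K m n * (h n)⁻¹ ^ q) ^ (p - 1) := by
          rw [ENNReal.mul_rpow_of_nonneg _ _ hp.le, ← ENNReal.rpow_mul, ← ENNReal.rpow_mul,
            one_div_mul_cancel hp.ne', ENNReal.rpow_one, hexp]
      _ ≤ _ := by gcongr; exact h1 m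
  calc ∑' m, W m * (∑' n, K m n * a n) ^ p
      ≤ ∑' m, W m * ((∑' n, K m n * h n ^ p * a n ^ p) * (C * U m) ^ (p - 1)) := by
        gcongr with m; exact key m
    _ = ∑' m, ∑' n, C ^ (p - 1) * a n ^ p * (W m * U m ^ (p - 1) * K m n * h n ^ p) := by
        congr 1 with m
        rw [ENNReal.mul_rpow_of_nonneg _ _ hp1, ← ENNReal.tsum_mul_right, ← ENNReal.tsum_mul_left]
        congr 1 with n
        ring
    _ = ∑' n, C ^ (p - 1) * a n ^ p * ∑' m, W m * U m ^ (p - 1) * K m n * h n ^ p := by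
        rw [ENNReal.tsum_comm]
        simp only [ENNReal.tsum_mul_left]
    _ ≤ ∑' n, C ^ (p - 1) * a n ^ p * (C * V n) := by
        gcongr with n; exact h2 n
    _ = C ^ p * ∑' n, V n * a n ^ p := by
        have : C ^ p = C ^ (p - 1) * C := by
          conv_rhs => rw [← ENNReal.rpow_one C, ← ENNReal.rpow_mul, one_mul,
            ← ENNReal.rpow_add_of_nonneg _ _ hp1 zero_le_one, sub_add_cancel]
        rw [this, ← ENNReal.tsum_mul_left]
        congr 1 with n
        ring

/-- The sum of an antitone function over the positive integers is at most its integral. -/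
theorem tsum_ofReal_le_setLIntegral_Ioi {f : ℝ → ℝ} (hf : AntitoneOn f (Set.Ioi 0)) :
    ∑' n : ℕ, ENNReal.ofReal (f (n + 1)) ≤ ∫⁻ x in Set.Ioi (0 : ℝ), ENNReal.ofReal (f x) := by
  have hdisj : Pairwise (Function.onFun Disjoint fun n : ℕ => Set.Ioc (n : ℝ) (n + 1)) := by
    have := (Nat.mono_cast (α := ℝ)).pairwise_disjoint_on_Ioc_succ
    simpa [Nat.succ_eq_succ] using this
  calc ∑' n : ℕ, ENNReal.ofReal (f (n + 1))
      ≤ ∑' n : ℕ, ∫⁻ x in Set.Ioc (n : ℝ) (n + 1), ENNReal.ofReal (f x) := by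
        gcongr with n
        calc ENNReal.ofReal (f (n + 1))
            = ∫⁻ _ in Set.Ioc (n : ℝ) (n + 1), ENNReal.ofReal (f (n + 1)) := by simp
          _ ≤ _ := by
            refine setLIntegral_mono' measurableSet_Ioc fun x hx => ENNReal.ofReal_le_ofReal ?_
            have hn : (0 : ℝ) ≤ n := n.cast_nonneg
            exact hf (lt_of_le_of_lt hn hx.1) (by simp; positivity) hx.2
    _ = ∫⁻ x in ⋃ n : ℕ, Set.Ioc (n : ℝ) (n + 1), ENNReal.ofReal (f x) :=
        (lintegral_iUnion (fun _ => measurableSet_Ioc) hdisj _).symm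
    _ ≤ _ := by
        refine lintegral_mono_set (Set.iUnion_subset fun n x hx => ?_)
        have hn : (0 : ℝ) ≤ n := n.cast_nonneg
        exact lt_of_le_of_lt hn hx.1

theorem setLIntegral_ofReal_rpow_mul_exp_neg_mul_Ioi {a r : ℝ} (ha : 0 < a) (hr : 0 < r) :
    ∫⁻ t in Set.Ioi (0 : ℝ), ENNReal.ofReal (t ^ (a - 1) * exp (-(r * t)))
      = ENNReal.ofReal (r ^ (-a) * Gamma a) := by
  rw [← ofReal_integral_eq_lintegral_ofReal, integral_rpow_mul_exp_neg_mul_Ioi ha hr, one_div,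
    inv_rpow hr.le, rpow_neg hr.le]
  · have := integrableOn_rpow_mul_exp_neg_mul_rpow (p := 1) (s := a - 1) (b := r)
      (by linarith) one_pos hr
    simpa [IntegrableOn] using this
  · filter_upwards [ae_restrict_mem measurableSet_Ioi] with t ht
    have : 0 < t := ht
    simp only [Pi.zero_apply]
    positivity

theorem ofReal_one_div_eq_setLIntegral_exp {r : ℝ} (hr : 0 < r) :
    ENNReal.ofReal (1 / r) = ∫⁻ t in Set.Ioi (0 : ℝ), ENNReal.ofReal (exp (-(r * t))) := by
  have := setLIntegral_ofReal_rpow_mul_exp_neg_mul_Ioi one_pos hr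
  simp only [sub_self, rpow_zero, one_mul, Gamma_one, mul_one, rpow_neg_one] at this
  rw [this, one_div]

/-- `∑ n, n ^ (-r) / (n + y) ≤ π / sin (π r) * y ^ (-r)`, the sum being over positive integers. -/
theorem tsum_ofReal_one_div_add_mul_rpow_neg_le {r y : ℝ} (hr : 0 < r) (hr1 : r < 1) (hy : 0 < y) :
    ∑' n : ℕ, ENNReal.ofReal (1 / ((n + 1 : ℝ) + y)) * ENNReal.ofReal ((n + 1 : ℝ) ^ (-r))
      ≤ ENNReal.ofReal (π / sin (π * r)) * ENNReal.ofReal (y ^ (-r)) := by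
  calc ∑' n : ℕ, ENNReal.ofReal (1 / ((n + 1 : ℝ) + y)) * ENNReal.ofReal ((n + 1 : ℝ) ^ (-r))
      = ∑' n : ℕ, ∫⁻ t in Set.Ioi (0 : ℝ), ENNReal.ofReal (exp (-(y * t))) *
          ENNReal.ofReal ((n + 1 : ℝ) ^ (-r) * exp (-(t * (n + 1)))) := by
        congr 1 with n
        rw [ofReal_one_div_eq_setLIntegral_exp (by positivity),
          ← lintegral_mul_const _ (by fun_prop)]
        congr 1 with t
        rw [← ENNReal.ofReal_mul (by positivity), ← ENNReal.ofReal_mul (by positivity),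
          show -((n + 1 + y) * t) = -(y * t) + -(t * (n + 1)) by ring, exp_add]
        ring_nf
    _ = ∫⁻ t in Set.Ioi (0 : ℝ), ENNReal.ofReal (exp (-(y * t))) *
          ∑' n : ℕ, ENNReal.ofReal ((n + 1 : ℝ) ^ (-r) * exp (-(t * (n + 1)))) := by
        rw [← lintegral_tsum fun n => by fun_prop]
        simp only [ENNReal.tsum_mul_left]
    _ ≤ ∫⁻ t in Set.Ioi (0 : ℝ), ENNReal.ofReal (exp (-(y * t))) *
          ENNReal.ofReal (t ^ (-(1 - r)) * Gamma (1 - r)) := by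
        refine setLIntegral_mono' measurableSet_Ioi fun t ht => ?_
        have ht : 0 < t := ht
        gcongr
        rw [← setLIntegral_ofReal_rpow_mul_exp_neg_mul_Ioi (by linarith) ht,
          show 1 - r - 1 = -r by ring]
        refine tsum_ofReal_le_setLIntegral_Ioi (f := fun x => x ^ (-r) * exp (-(t * x))) ?_
        intro x hx z hz hxz
        have hx : 0 < x := hx
        have hz : 0 < z := hz
        have h1 : z ^ (-r) ≤ x ^ (-r) := rpow_le_rpow_of_nonpos hx hxz (by linarith)
        have h2 : exp (-(t * z)) ≤ exp (-(t * x)) := by gcongr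
        exact mul_le_mul h1 h2 (by positivity) (by positivity)
    _ = ∫⁻ t in Set.Ioi (0 : ℝ), ENNReal.ofReal (Gamma (1 - r)) *
          ENNReal.ofReal (t ^ (r - 1) * exp (-(y * t))) := by
        refine setLIntegral_congr_fun measurableSet_Ioi fun t ht => ?_
        have ht : 0 < t := ht
        have hG : 0 < Gamma (1 - r) := Gamma_pos_of_pos (by linarith)
        rw [← ENNReal.ofReal_mul (by positivity), ← ENNReal.ofReal_mul hG.le, neg_sub]
        ring_nf
    _ = ENNReal.ofReal (π / sin (π * r)) * ENNReal.ofReal (y ^ (-r)) := by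
        have hG : 0 < Gamma (1 - r) := Gamma_pos_of_pos (by linarith)
        have hG' : 0 < Gamma r := Gamma_pos_of_pos hr
        rw [lintegral_const_mul _ (by fun_prop),
          setLIntegral_ofReal_rpow_mul_exp_neg_mul_Ioi hr hy, ← Gamma_mul_Gamma_one_sub,
          ← ENNReal.ofReal_mul (by positivity), ← ENNReal.ofReal_mul (by positivity)]
        ring_nf

/-- The weighted Hilbert inequality in `ℓ^p` with its sharp constant. -/
theorem tsum_rpow_mul_tsum_one_div_add_rpow_le {p α : ℝ} (hp : 1 < p) (hα : -1 < α)
    (hα' : α < p - 1) (a : ℕ → ENNReal) :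
    ∑' m : ℕ, ENNReal.ofReal ((m + 1 : ℝ) ^ α) *
        (∑' n : ℕ, ENNReal.ofReal (1 / ((m + 1 : ℝ) + (n + 1))) * a n) ^ p
      ≤ ENNReal.ofReal (π / sin (π * (1 + α) / p)) ^ p *
        ∑' n : ℕ, ENNReal.ofReal ((n + 1 : ℝ) ^ α) * a n ^ p := by
  have hp0 : 0 < p := by linarith
  obtain ⟨θ, hθ⟩ : ∃ θ, θ = (1 + α) / p := ⟨_, rfl⟩
  have hαθ : α = θ * p - 1 := by rw [hθ]; field_simp; ring
  have hθ0 : 0 < θ := by rw [hθ]; exact div_pos (by linarith) hp0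
  have hθ1 : θ < 1 := by rw [hθ, div_lt_one hp0]; linarith
  have hpq := Real.HolderConjugate.conjExponent hp
  have hs : π * (1 + α) / p = π * θ := by rw [hθ]; ring
  have hpos (n : ℕ) : (0 : ℝ) < n + 1 := by positivity
  rw [hs]
  refine ENNReal.tsum_mul_tsum_rpow_le_of_schur hpq _
    (fun n => ENNReal.ofReal ((n + 1 : ℝ) ^ (θ * (p - 1) / p)))
    (fun n => ENNReal.ofReal ((n + 1 : ℝ) ^ (-θ))) _ _ a _ (fun n => ?_) (fun n => by simp)
    (fun m => ?_) (fun n => ?_)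
  · simpa using rpow_pos_of_pos (hpos n) _
  · refine le_trans (le_of_eq ?_) (tsum_ofReal_one_div_add_mul_rpow_neg_le hθ0 hθ1 (hpos m))
    congr 1 with n
    rw [← ENNReal.ofReal_inv_of_pos (rpow_pos_of_pos (hpos n) _), ← rpow_neg (hpos n).le,
      ENNReal.ofReal_rpow_of_pos (rpow_pos_of_pos (hpos n) _), ← rpow_mul (hpos n).le,
      add_comm ((n : ℝ) + 1)]
    congr 3
    have : p - 1 ≠ 0 := by linarith
    rw [Real.conjExponent]
    field_simp
  · have hsin : sin (π * θ) = sin (π * (1 - θ)) := by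
      rw [← sin_pi_sub]; ring_nf
    calc _ = (∑' m : ℕ, ENNReal.ofReal (1 / ((m + 1 : ℝ) + (n + 1))) *
            ENNReal.ofReal ((m + 1 : ℝ) ^ (-(1 - θ)))) *
            ENNReal.ofReal ((n + 1 : ℝ) ^ (θ * (p - 1))) := by
          rw [← ENNReal.tsum_mul_right]
          congr 1 with m
          rw [ENNReal.ofReal_rpow_of_pos (rpow_pos_of_pos (hpos n) _), ← rpow_mul (hpos n).le,
            ENNReal.ofReal_rpow_of_pos (rpow_pos_of_pos (hpos m) _), ← rpow_mul (hpos m).le,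
            div_mul_cancel₀ _ hp0.ne', ← ENNReal.ofReal_mul (rpow_pos_of_pos (hpos m) _).le,
            ← rpow_add (hpos m), mul_comm (ENNReal.ofReal ((m + 1 : ℝ) ^ _))]
          congr 4
          rw [hαθ]; ring
      _ ≤ ENNReal.ofReal (π / sin (π * (1 - θ))) * ENNReal.ofReal ((n + 1 : ℝ) ^ (-(1 - θ))) *
            ENNReal.ofReal ((n + 1 : ℝ) ^ (θ * (p - 1))) := by
          gcongr
          exact tsum_ofReal_one_div_add_mul_rpow_neg_le (by linarith) (by linarith) (hpos n)
      _ = _ := by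
          rw [mul_assoc, ← ENNReal.ofReal_mul (rpow_pos_of_pos (hpos n) _).le,
            ← rpow_add (hpos n), hsin]
          congr 3
          rw [hαθ]; ring

theorem ENNReal.ofReal_tsum_le_tsum_ofReal {ι : Type*} {f : ι → ℝ} (hf : ∀ i, 0 ≤ f i) :
    ENNReal.ofReal (∑' i, f i) ≤ ∑' i, ENNReal.ofReal (f i) := by
  by_cases h : Summable f
  · exact (ENNReal.ofReal_tsum_of_nonneg hf h).le
  · simp [tsum_eq_zero_of_not_summable h]

theorem integral_pow_mul_nonneg {g : ℝ → ℝ} (hg : ∀ t ∈ Set.Ico (0 : ℝ) 1, 0 ≤ g t) (k : ℕ) :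
    0 ≤ ∫ t in (0 : ℝ)..1, t ^ k * g t := by
  rw [intervalIntegral.integral_of_le zero_le_one, integral_Ioc_eq_integral_Ioo]
  exact setIntegral_nonneg measurableSet_Ioo fun t ht =>
    mul_nonneg (pow_nonneg ht.1.le _) (hg t ⟨ht.1.le, ht.2⟩)

theorem integral_pow_mul_le {g : ℝ → ℝ} {M : ℝ} (hM : 0 ≤ M)
    (hg : ∀ t ∈ Set.Ico (0 : ℝ) 1, g t ≤ M) (k : ℕ) :
    ∫ t in (0 : ℝ)..1, t ^ k * g t ≤ M * (1 / (k + 1)) := by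
  by_cases h : IntervalIntegrable (fun t => t ^ k * g t) volume 0 1
  · calc ∫ t in (0 : ℝ)..1, t ^ k * g t ≤ ∫ t in (0 : ℝ)..1, t ^ k * M := by
          refine intervalIntegral.integral_mono_on_of_le_Ioo zero_le_one h
            (Continuous.intervalIntegrable (by fun_prop) _ _) fun t ht => ?_
          exact mul_le_mul_of_nonneg_left (hg t ⟨ht.1.le, ht.2⟩) (pow_nonneg ht.1.le _)
      _ = M * (1 / (k + 1)) := by
          rw [intervalIntegral.integral_mul_const, integral_pow]
          simp [mul_comm]
  · rw [intervalIntegral.integral_undef h]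
    positivity

theorem stmt_9 (p α : ℝ) (hp : 1 < p) (hα : -1 < α) (hα' : α < p - 1)
    (g : ℝ → ℝ) (hg0 : ∀ t ∈ Set.Ico (0:ℝ) 1, 0 ≤ g t)
    (hgmono : MonotoneOn g (Set.Ico (0:ℝ) 1))
    (hgbdd : BddAbove (g '' Set.Ico (0:ℝ) 1))
    (hgpos : 0 < sSup (g '' Set.Ico (0:ℝ) 1)) :
    ∀ a : ℕ → ℝ, (∀ n, 0 ≤ a n) →
      Summable (fun n : ℕ => ((n : ℝ) + 1) ^ α * (a n) ^ p) →
      (∑' m : ℕ, ((m : ℝ) + 1) ^ α *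
          (∑' n : ℕ, a n * ∫ t in (0:ℝ)..1, t ^ (m + n + 1) * g t) ^ p) ^ (1/p)
        ≤ sSup (g '' Set.Ico (0:ℝ) 1) * π * (Real.sin (π * (1 + α) / p))⁻¹ *
            (∑' n : ℕ, ((n : ℝ) + 1) ^ α * (a n) ^ p) ^ (1/p) := by
  intro a ha hsum
  set M := sSup (g '' Set.Ico (0 : ℝ) 1) with hM
  have hgM : ∀ t ∈ Set.Ico (0 : ℝ) 1, g t ≤ M := fun t ht =>
    le_csSup hgbdd (Set.mem_image_of_mem g ht)
  have hp0 : 0 < p := by linarith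
  have hsin : 0 < sin (π * (1 + α) / p) := by
    apply sin_pos_of_pos_of_lt_pi
    · exact div_pos (mul_pos pi_pos (by linarith)) hp0
    · rw [div_lt_iff₀ hp0]
      exact mul_lt_mul_of_pos_left (by linarith) pi_pos
  have hI (k : ℕ) := integral_pow_mul_nonneg hg0 k
  have hterm (n : ℕ) : 0 ≤ ((n : ℝ) + 1) ^ α * a n ^ p :=
    mul_nonneg (by positivity) (rpow_nonneg (ha n) _)
  have hin (m : ℕ) : 0 ≤ ∑' n : ℕ, a n * ∫ t in (0:ℝ)..1, t ^ (m + n + 1) * g t :=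
    tsum_nonneg fun n => mul_nonneg (ha n) (hI _)
  have hS : 0 ≤ ∑' n : ℕ, ((n : ℝ) + 1) ^ α * a n ^ p := tsum_nonneg hterm
  have hC : 0 ≤ π / sin (π * (1 + α) / p) := by positivity
  have hinner (m : ℕ) :
      ENNReal.ofReal (∑' n : ℕ, a n * ∫ t in (0:ℝ)..1, t ^ (m + n + 1) * g t) ≤
        ENNReal.ofReal M *
          ∑' n : ℕ, ENNReal.ofReal (1 / ((m + 1 : ℝ) + (n + 1))) * ENNReal.ofReal (a n) := by
    refine (ENNReal.ofReal_tsum_le_tsum_ofReal fun n => mul_nonneg (ha n) (hI _)).trans ?_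
    rw [← ENNReal.tsum_mul_left]
    gcongr with n
    rw [← ENNReal.ofReal_mul (by positivity), ← ENNReal.ofReal_mul hgpos.le]
    apply ENNReal.ofReal_le_ofReal
    calc _ ≤ a n * (M * (1 / ((m + n + 1 : ℕ) + 1))) :=
          mul_le_mul_of_nonneg_left (integral_pow_mul_le hgpos.le hgM _) (ha n)
      _ = _ := by push_cast; ring
  have main : ∑' m : ℕ, ((m : ℝ) + 1) ^ α *
      (∑' n : ℕ, a n * ∫ t in (0:ℝ)..1, t ^ (m + n + 1) * g t) ^ p ≤
      (M * (π / sin (π * (1 + α) / p))) ^ p * ∑' n : ℕ, ((n : ℝ) + 1) ^ α * a n ^ p := by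
    rw [← ENNReal.ofReal_le_ofReal_iff (by positivity)]
    calc _ ≤ ∑' m : ℕ, ENNReal.ofReal (((m : ℝ) + 1) ^ α *
            (∑' n : ℕ, a n * ∫ t in (0:ℝ)..1, t ^ (m + n + 1) * g t) ^ p) :=
          ENNReal.ofReal_tsum_le_tsum_ofReal fun m =>
            mul_nonneg (by positivity) (rpow_nonneg (hin m) _)
      _ ≤ ∑' m : ℕ, ENNReal.ofReal M ^ p * (ENNReal.ofReal (((m : ℝ) + 1) ^ α) *
            (∑' n : ℕ, ENNReal.ofReal (1 / ((m + 1 : ℝ) + (n + 1))) *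
              ENNReal.ofReal (a n)) ^ p) := by
          gcongr with m
          rw [ENNReal.ofReal_mul (by positivity), mul_left_comm,
            ← ENNReal.mul_rpow_of_nonneg _ _ hp0.le, ← ENNReal.ofReal_rpow_of_nonneg (hin m) hp0.le]
          gcongr
          exact hinner m
      _ ≤ ENNReal.ofReal M ^ p * (ENNReal.ofReal (π / sin (π * (1 + α) / p)) ^ p *
            ∑' n : ℕ, ENNReal.ofReal ((n + 1 : ℝ) ^ α) * ENNReal.ofReal (a n) ^ p) := by
          rw [ENNReal.tsum_mul_left]
          gcongr
          exact tsum_rpow_mul_tsum_one_div_add_rpow_le hp hα hα' _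
      _ = _ := by
          rw [← mul_assoc, ← ENNReal.mul_rpow_of_nonneg _ _ hp0.le, ← ENNReal.ofReal_mul hgpos.le,
            ENNReal.ofReal_rpow_of_nonneg (by positivity) hp0.le,
            ENNReal.ofReal_mul (by positivity), ENNReal.ofReal_tsum_of_nonneg hterm hsum]
          congr 2 with n
          rw [ENNReal.ofReal_mul (by positivity), ENNReal.ofReal_rpow_of_nonneg (ha n) hp0.le]
  calc _ ≤ ((M * (π / sin (π * (1 + α) / p))) ^ p *
          ∑' n : ℕ, ((n : ℝ) + 1) ^ α * a n ^ p) ^ (1 / p) := by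
        refine rpow_le_rpow (tsum_nonneg fun m => ?_) main (by positivity)
        exact mul_nonneg (by positivity) (rpow_nonneg (hin m) _)
    _ = _ := by
        rw [mul_rpow (by positivity) hS, ← rpow_mul (by positivity), mul_one_div_cancel hp0.ne',
          rpow_one]
        ring
end

section
/- Let p > 1 and -1 < α < p-1, and let g: [0,1) → ℝ be non-negative, non-decreasing, bounded with ‖g‖_∞ > 0. Then the operator norm of H_g from l^p_α to l^p_α equals exactly ‖g‖_∞ · π csc(π(1+α)/p). -/
open MeasureTheory Real
open scoped ENNReal

theorem lintegral_rpow_mul_exp_neg_mul_Ioi {a r : ℝ} (ha : 0 < a) (hr : 0 < r) :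
    ∫⁻ t in Set.Ioi (0:ℝ), ENNReal.ofReal (t ^ (a - 1) * exp (-(r * t)))
      = ENNReal.ofReal ((1 / r) ^ a * Gamma a) := by
  have h := integral_rpow_mul_exp_neg_mul_Ioi ha hr
  have hpos : 0 < (1 / r) ^ a * Gamma a :=
    mul_pos (rpow_pos_of_pos (by positivity) _) (Gamma_pos_of_pos ha)
  rw [← h, ofReal_integral_eq_lintegral_ofReal]
  · exact Integrable.of_integral_ne_zero (by rw [h]; exact hpos.ne')
  · refine (ae_restrict_mem measurableSet_Ioi).mono fun t ht ↦ ?_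
    have : 0 < t := ht
    simp only [Pi.zero_apply]
    positivity

theorem lintegral_rpow_neg_div_add {s x : ℝ} (hs : 0 < s) (hs1 : s < 1) (hx : 0 < x) :
    ∫⁻ y in Set.Ioi (0:ℝ), ENNReal.ofReal (y ^ (-s) / (x + y))
      = ENNReal.ofReal (x ^ (-s) * (π / sin (π * s))) := by
  have h1 : ∀ y ∈ Set.Ioi (0:ℝ), ENNReal.ofReal (y ^ (-s) / (x + y)) =
      ∫⁻ u in Set.Ioi (0:ℝ), ENNReal.ofReal (y ^ (-s) * exp (-((x + y) * u))) := by
    intro y hy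
    have hy : 0 < y := hy
    have h := lintegral_rpow_mul_exp_neg_mul_Ioi (a := 1) (r := x + y) one_pos (by positivity)
    simp only [sub_self, rpow_zero, one_mul, rpow_one, Gamma_one, mul_one] at h
    simp_rw [ENNReal.ofReal_mul (rpow_nonneg hy.le (-s))]
    rw [lintegral_const_mul _ (by fun_prop), h, ← ENNReal.ofReal_mul (rpow_nonneg hy.le (-s)),
      mul_one_div]
  have h2 : ∀ u ∈ Set.Ioi (0:ℝ),
      ∫⁻ y in Set.Ioi (0:ℝ), ENNReal.ofReal (y ^ (-s) * exp (-((x + y) * u))) =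
      ENNReal.ofReal (Gamma (1 - s)) * ENNReal.ofReal (u ^ (s - 1) * exp (-(x * u))) := by
    intro u hu
    have hu : 0 < u := hu
    have h := lintegral_rpow_mul_exp_neg_mul_Ioi (a := 1 - s) (r := u) (by linarith) hu
    have e : ∀ y : ℝ, y ^ (-s) * exp (-((x + y) * u)) =
        exp (-(x * u)) * (y ^ (1 - s - 1) * exp (-(u * y))) := by
      intro y
      rw [show 1 - s - 1 = -s by ring, show -((x + y) * u) = -(x * u) + -(u * y) by ring, exp_add]
      ring
    simp_rw [e, ENNReal.ofReal_mul (exp_nonneg (-(x * u)))]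
    rw [lintegral_const_mul _ (by fun_prop), h, ← ENNReal.ofReal_mul (exp_nonneg _),
      ← ENNReal.ofReal_mul (Gamma_pos_of_pos (by linarith : 0 < 1 - s)).le]
    congr 1
    rw [one_div, inv_rpow hu.le, ← rpow_neg hu.le, neg_sub]
    ring
  rw [setLIntegral_congr_fun measurableSet_Ioi h1, lintegral_lintegral_swap (by fun_prop),
    setLIntegral_congr_fun measurableSet_Ioi h2, lintegral_const_mul _ (by fun_prop),
    lintegral_rpow_mul_exp_neg_mul_Ioi hs hx,
    ← ENNReal.ofReal_mul (Gamma_pos_of_pos (by linarith : 0 < 1 - s)).le,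
    ← Gamma_mul_Gamma_one_sub, one_div, inv_rpow hx.le, ← rpow_neg hx.le]
  congr 1
  ring

theorem tsum_rpow_neg_div_add_le {s x : ℝ} (hs : 0 < s) (hs1 : s < 1) (hx : 0 < x) :
    ∑' n : ℕ, ENNReal.ofReal (((n:ℝ) + 1) ^ (-s) / (x + (n + 1)))
      ≤ ENNReal.ofReal (x ^ (-s) * (π / sin (π * s))) := by
  rw [← lintegral_rpow_neg_div_add hs hs1 hx]
  have hdisj : Pairwise (Function.onFun Disjoint fun n : ℕ ↦ Set.Ioc (n:ℝ) (n + 1)) := by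
    intro i j hij
    simpa [Function.onFun] using
      Set.pairwise_disjoint_Ioc_intCast ℝ (Nat.cast_injective (R := ℤ) |>.ne hij)
  calc _ ≤ ∑' n : ℕ, ∫⁻ y in Set.Ioc (n:ℝ) (n + 1), ENNReal.ofReal (y ^ (-s) / (x + y)) := by
        refine ENNReal.tsum_le_tsum fun n ↦ ?_
        calc _ = ∫⁻ y in Set.Ioc (n:ℝ) (n + 1),
              ENNReal.ofReal (((n:ℝ) + 1) ^ (-s) / (x + (n + 1))) := by simp
          _ ≤ _ := by
            refine setLIntegral_mono (by fun_prop) fun y hy ↦ ENNReal.ofReal_le_ofReal ?_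
            have hy0 : 0 < y := lt_of_le_of_lt (Nat.cast_nonneg n) hy.1
            have h1 : ((n:ℝ) + 1) ^ (-s) ≤ y ^ (-s) :=
              rpow_le_rpow_of_nonpos hy0 hy.2 (by linarith)
            have := hy.2
            gcongr
    _ = ∫⁻ y in ⋃ n : ℕ, Set.Ioc (n:ℝ) (n + 1), ENNReal.ofReal (y ^ (-s) / (x + y)) :=
        (lintegral_iUnion (fun _ ↦ measurableSet_Ioc) hdisj _).symm
    _ ≤ _ := lintegral_mono_set (Set.iUnion_subset fun n y hy ↦
        lt_of_le_of_lt (Nat.cast_nonneg n) hy.1)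

theorem ENNReal.rpow_tsum_mul_le {ι : Type*} {p : ℝ} (hp : 1 ≤ p) (w f : ι → ℝ≥0∞) :
    (∑' i, w i * f i) ^ p ≤ (∑' i, w i) ^ (p - 1) * ∑' i, w i * f i ^ p := by
  have hp0 : 0 < p := by linarith
  have h : ∑' i, w i * f i ≤ (∑' i, w i) ^ (1 - p⁻¹) * (∑' i, w i * f i ^ p) ^ p⁻¹ := by
    rw [ENNReal.tsum_eq_iSup_sum]
    refine iSup_le fun t ↦ (ENNReal.inner_le_weight_mul_Lp_of_nonneg t hp w f).trans ?_
    have : 0 ≤ 1 - p⁻¹ := sub_nonneg.2 (inv_le_one_of_one_le₀ hp)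
    gcongr <;> exact ENNReal.sum_le_tsum t
  calc _ ≤ ((∑' i, w i) ^ (1 - p⁻¹) * (∑' i, w i * f i ^ p) ^ p⁻¹) ^ p := by gcongr
    _ = _ := by
      rw [ENNReal.mul_rpow_of_nonneg _ _ hp0.le, ← ENNReal.rpow_mul, ← ENNReal.rpow_mul,
        inv_mul_cancel₀ hp0.ne', ENNReal.rpow_one, sub_mul, inv_mul_cancel₀ hp0.ne', one_mul]

theorem tsum_hilbert_rpow_le {p α : ℝ} (hp : 1 < p) (hα : -1 < α) (hα' : α < p - 1)
    (A : ℕ → ℝ≥0∞) :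
    ∑' m : ℕ, ENNReal.ofReal (((m:ℝ) + 1) ^ α) *
        (∑' n : ℕ, ENNReal.ofReal (1 / ((m:ℝ) + n + 2)) * A n) ^ p
      ≤ ENNReal.ofReal (π / sin (π * ((1 + α) / p))) ^ p *
        ∑' n : ℕ, ENNReal.ofReal (((n:ℝ) + 1) ^ α) * A n ^ p := by
  set s := (1 + α) / p
  have hp0 : 0 < p := by linarith
  have hs : 0 < s := div_pos (by linarith) hp0
  have hs1 : s < 1 := (div_lt_one hp0).2 (by linarith)
  have hsp : s * p = 1 + α := div_mul_cancel₀ _ hp0.ne'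
  set C := π / sin (π * s) with hC_def
  have hC : 0 < C := div_pos pi_pos (sin_pos_of_pos_of_lt_pi (by positivity)
    (by nlinarith [pi_pos]))
  have row : ∀ m : ℕ, ENNReal.ofReal (((m:ℝ) + 1) ^ α) *
      (∑' n : ℕ, ENNReal.ofReal (1 / ((m:ℝ) + n + 2)) * A n) ^ p ≤
      ∑' n : ℕ, ENNReal.ofReal C ^ (p - 1) * (ENNReal.ofReal (((n:ℝ) + 1) ^ (s * (p - 1))) *
        A n ^ p) * ENNReal.ofReal (((m:ℝ) + 1) ^ (-(1 - s)) / (((n:ℝ) + 1) + (m + 1))) := by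
    intro m
    have hm : (0:ℝ) < m + 1 := by positivity
    have e : ∀ n : ℕ, ENNReal.ofReal (1 / ((m:ℝ) + n + 2)) * A n =
        ENNReal.ofReal (((n:ℝ) + 1) ^ (-s) / ((m + 1) + (n + 1))) *
          (ENNReal.ofReal (((n:ℝ) + 1) ^ s) * A n) := by
      intro n
      have hn : (0:ℝ) < n + 1 := by positivity
      rw [← mul_assoc, ← ENNReal.ofReal_mul (by positivity)]
      congr 2
      rw [rpow_neg hn.le]
      have := (rpow_pos_of_pos hn s).ne'
      field_simp
      ring
    simp_rw [e]
    refine (mul_le_mul_right (ENNReal.rpow_tsum_mul_le hp.le _ _) _).trans ?_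
    have h1 := tsum_rpow_neg_div_add_le hs hs1 hm
    refine (mul_le_mul_right (mul_le_mul_left (ENNReal.rpow_le_rpow h1
      (by linarith : 0 ≤ p - 1)) _) _).trans ?_
    rw [← ENNReal.tsum_mul_left, ← ENNReal.tsum_mul_left]
    refine ENNReal.tsum_le_tsum fun n ↦ le_of_eq ?_
    have hn : (0:ℝ) < n + 1 := by positivity
    rw [ENNReal.mul_rpow_of_nonneg _ _ hp0.le,
      ENNReal.ofReal_rpow_of_nonneg (by positivity) hp0.le,
      ENNReal.ofReal_rpow_of_nonneg (by positivity) (by linarith),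
      ENNReal.ofReal_rpow_of_nonneg (by positivity) (by linarith)]
    simp only [← mul_assoc]
    rw [mul_right_comm _ (A n ^ p)]
    congr 1
    rw [← ENNReal.ofReal_mul (by positivity), ← ENNReal.ofReal_mul (by positivity),
      ← ENNReal.ofReal_mul (by positivity), ← ENNReal.ofReal_mul (by positivity),
      ← ENNReal.ofReal_mul (by positivity)]
    congr 1
    rw [mul_rpow (by positivity) hC.le, ← rpow_mul hm.le, ← rpow_mul hn.le]
    have e1 : ((m:ℝ) + 1) ^ (-(1 - s)) = ((m:ℝ) + 1) ^ α * ((m:ℝ) + 1) ^ (-s * (p - 1)) := by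
      rw [← rpow_add hm]; congr 1; linarith
    have e2 : ((n:ℝ) + 1) ^ (s * (p - 1)) = ((n:ℝ) + 1) ^ (-s) * ((n:ℝ) + 1) ^ (s * p) := by
      rw [← rpow_add hn]; congr 1; ring
    rw [e1, e2, add_comm ((m:ℝ) + 1)]
    ring
  refine (ENNReal.tsum_le_tsum row).trans ?_
  rw [ENNReal.tsum_comm, ← ENNReal.tsum_mul_left]
  refine ENNReal.tsum_le_tsum fun n ↦ ?_
  have hn : (0:ℝ) < n + 1 := by positivity
  rw [ENNReal.tsum_mul_left]
  have h2 := tsum_rpow_neg_div_add_le (s := 1 - s) (by linarith) (by linarith) hn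
  rw [show π * (1 - s) = π - π * s by ring, sin_pi_sub, ← hC_def] at h2
  refine (mul_le_mul_right h2 _).trans (le_of_eq ?_)
  rw [ENNReal.ofReal_rpow_of_nonneg hC.le (by linarith), ENNReal.ofReal_rpow_of_nonneg hC.le hp0.le]
  simp only [← mul_assoc]
  rw [mul_right_comm _ (A n ^ p)]
  congr 1
  rw [← ENNReal.ofReal_mul (by positivity), ← ENNReal.ofReal_mul (by positivity),
      ← ENNReal.ofReal_mul (by positivity)]
  congr 1
  have e1 : C ^ p = C ^ (p - 1) * C := by
    rw [← rpow_add_one hC.ne']; congr 1; ring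
  have e2 : ((n:ℝ) + 1) ^ α = ((n:ℝ) + 1) ^ (s * (p - 1)) * ((n:ℝ) + 1) ^ (-(1 - s)) := by
    rw [← rpow_add hn]; congr 1; linarith
  rw [e1, e2]
  ring

theorem tsum_moment_rpow_le {p α G : ℝ} (hp : 1 < p) (hα : -1 < α) (hα' : α < p - 1)
    (hG : 0 ≤ G) {Λ : ℕ → ℝ} (hΛ0 : ∀ k, 0 ≤ Λ k) (hΛ : ∀ k, Λ k ≤ G / (k + 1)) {a : ℕ → ℝ}
    (ha : Summable (fun n : ℕ => ((n : ℝ) + 1) ^ α * |a n| ^ p)) :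
    Summable (fun m : ℕ => ((m : ℝ) + 1) ^ α * |∑' n : ℕ, a n * Λ (m + n + 1)| ^ p) ∧
    ∑' m : ℕ, ((m : ℝ) + 1) ^ α * |∑' n : ℕ, a n * Λ (m + n + 1)| ^ p ≤
      (G * (π / sin (π * ((1 + α) / p)))) ^ p *
        ∑' n : ℕ, ((n : ℝ) + 1) ^ α * |a n| ^ p := by
  have hp0 : 0 < p := by linarith
  set C := π / sin (π * ((1 + α) / p))
  have hC : 0 ≤ C := by
    have hs : 0 < (1 + α) / p := div_pos (by linarith) hp0
    have hs1 : (1 + α) / p < 1 := (div_lt_one hp0).2 (by linarith)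
    exact div_nonneg pi_pos.le (sin_nonneg_of_nonneg_of_le_pi (by positivity)
      (by nlinarith [pi_pos]))
  have hterm : ∀ m : ℕ, ENNReal.ofReal |∑' n : ℕ, a n * Λ (m + n + 1)| ≤
      ENNReal.ofReal G *
        ∑' n : ℕ, ENNReal.ofReal (1 / ((m:ℝ) + n + 2)) * ENNReal.ofReal |a n| := by
    intro m
    rw [← Real.norm_eq_abs, ofReal_norm, ← ENNReal.tsum_mul_left]
    refine enorm_tsum_le_tsum_enorm.trans (ENNReal.tsum_le_tsum fun n ↦ ?_)
    rw [← ofReal_norm, norm_mul, Real.norm_eq_abs, Real.norm_eq_abs, abs_of_nonneg (hΛ0 _),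
      ← ENNReal.ofReal_mul (by positivity), ← ENNReal.ofReal_mul hG]
    refine ENNReal.ofReal_le_ofReal ?_
    have h := hΛ (m + n + 1)
    push_cast at h
    rw [mul_comm |a n|, ← mul_assoc, mul_one_div]
    refine mul_le_mul_of_nonneg_right (h.trans_eq ?_) (abs_nonneg _)
    congr 1
    ring
  have ofReal_term : ∀ (n : ℕ) (x : ℝ), ENNReal.ofReal (((n:ℝ) + 1) ^ α * |x| ^ p) =
      ENNReal.ofReal (((n:ℝ) + 1) ^ α) * ENNReal.ofReal |x| ^ p := by
    intro n x
    rw [ENNReal.ofReal_mul (by positivity), ENNReal.ofReal_rpow_of_nonneg (abs_nonneg _) hp0.le]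
  have key : ∑' m : ℕ, ENNReal.ofReal
        (((m : ℝ) + 1) ^ α * |∑' n : ℕ, a n * Λ (m + n + 1)| ^ p) ≤
      ENNReal.ofReal ((G * C) ^ p * ∑' n : ℕ, ((n : ℝ) + 1) ^ α * |a n| ^ p) := by
    rw [ENNReal.ofReal_mul (by positivity),
      ENNReal.ofReal_tsum_of_nonneg (fun n ↦ by positivity) ha,
      ← ENNReal.ofReal_rpow_of_nonneg (by positivity) hp0.le, ENNReal.ofReal_mul hG,
      ENNReal.mul_rpow_of_nonneg _ _ hp0.le, mul_assoc]
    simp_rw [ofReal_term]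
    refine le_trans ?_ (mul_le_mul_right (tsum_hilbert_rpow_le hp hα hα' _) _)
    rw [← ENNReal.tsum_mul_left]
    refine ENNReal.tsum_le_tsum fun m ↦ ?_
    refine (mul_le_mul_right (ENNReal.rpow_le_rpow (hterm m) hp0.le) _).trans_eq ?_
    rw [ENNReal.mul_rpow_of_nonneg _ _ hp0.le, mul_left_comm]
  have hnn : ∀ m : ℕ, 0 ≤ ((m : ℝ) + 1) ^ α * |∑' n : ℕ, a n * Λ (m + n + 1)| ^ p :=
    fun m ↦ by positivity
  have hsum : Summable (fun m : ℕ =>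
      ((m : ℝ) + 1) ^ α * |∑' n : ℕ, a n * Λ (m + n + 1)| ^ p) := by
    have h := ENNReal.summable_toReal (ne_top_of_le_ne_top ENNReal.ofReal_ne_top key)
    simpa only [ENNReal.toReal_ofReal (hnn _)] using h
  refine ⟨hsum, ?_⟩
  rw [← ENNReal.ofReal_tsum_of_nonneg hnn hsum] at key
  exact (ENNReal.ofReal_le_ofReal_iff
    (mul_nonneg (by positivity) (tsum_nonneg fun n ↦ by positivity))).1 key

theorem integrableOn_rpow_neg_div_add {s x : ℝ} (hs : 0 < s) (hs1 : s < 1) (hx : 0 < x) :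
    IntegrableOn (fun y : ℝ ↦ y ^ (-s) / (x + y)) (Set.Ioi 0) := by
  have hmeas : Measurable (fun y : ℝ ↦ y ^ (-s) / (x + y)) := by fun_prop
  refine ⟨hmeas.aestronglyMeasurable, ?_⟩
  rw [hasFiniteIntegral_iff_ofReal, lintegral_rpow_neg_div_add hs hs1 hx]
  · exact ENNReal.ofReal_lt_top
  · refine (ae_restrict_mem measurableSet_Ioi).mono fun t ht ↦ ?_
    have : 0 < t := ht
    simp only [Pi.zero_apply]
    positivity

theorem integral_rpow_neg_div_one_add {s : ℝ} (hs : 0 < s) (hs1 : s < 1) :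
    ∫ y in Set.Ioi (0:ℝ), y ^ (-s) / (1 + y) = π / sin (π * s) := by
  have hC : 0 < π / sin (π * s) := div_pos pi_pos (sin_pos_of_pos_of_lt_pi (by positivity)
    (by nlinarith [pi_pos]))
  rw [integral_eq_lintegral_of_nonneg_ae _
    (integrableOn_rpow_neg_div_add hs hs1 one_pos).aestronglyMeasurable,
    lintegral_rpow_neg_div_add hs hs1 one_pos, one_rpow, one_mul, ENNReal.toReal_ofReal hC.le]
  refine (ae_restrict_mem measurableSet_Ioi).mono fun t ht ↦ ?_
  have : 0 < t := ht
  simp only [Pi.zero_apply]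
  positivity

theorem tendsto_integral_inv_rpow_neg_div_one_add {s : ℝ} (hs : 0 < s) (hs1 : s < 1) :
    Filter.Tendsto (fun M : ℕ ↦ ∫ y in (M:ℝ)⁻¹..M, y ^ (-s) / (1 + y)) Filter.atTop
      (nhds (π / sin (π * s))) := by
  rw [← integral_rpow_neg_div_one_add hs hs1, ← Filter.tendsto_add_atTop_iff_nat 1]
  have hU : ⋃ M : ℕ, Set.Ioc (((M + 1 : ℕ):ℝ)⁻¹) ((M + 1 : ℕ):ℝ) = Set.Ioi 0 := by
    ext y
    simp only [Set.mem_iUnion, Set.mem_Ioc, Set.mem_Ioi]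
    refine ⟨fun ⟨M, h, _⟩ ↦ lt_trans (by positivity) h, fun hy ↦ ?_⟩
    obtain ⟨M, hM⟩ := exists_nat_gt (max y y⁻¹)
    have hM' : max y y⁻¹ < ((M + 1 : ℕ):ℝ) := hM.trans (by push_cast; linarith)
    exact ⟨M, inv_lt_of_inv_lt₀ hy ((le_max_right _ _).trans_lt hM'),
      ((le_max_left _ _).trans_lt hM').le⟩
  have h := tendsto_setIntegral_of_monotone (μ := volume)
    (f := fun y : ℝ ↦ y ^ (-s) / (1 + y))
    (s := fun M : ℕ ↦ Set.Ioc (((M + 1 : ℕ):ℝ)⁻¹) ((M + 1 : ℕ):ℝ))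
    (fun _ ↦ measurableSet_Ioc)
    (fun i j hij ↦ Set.Ioc_subset_Ioc (by gcongr) (by gcongr))
    (by rw [hU]; exact integrableOn_rpow_neg_div_add hs hs1 one_pos)
  rw [hU] at h
  refine h.congr fun M ↦ (intervalIntegral.integral_of_le ?_).symm
  have : (1:ℝ) ≤ ((M + 1 : ℕ):ℝ) := by push_cast; linarith [Nat.cast_nonneg (α := ℝ) M]
  exact (inv_le_one_of_one_le₀ this).trans this

theorem rpow_neg_mul_integral_le_sum {s x : ℝ} (hs : 0 < s) {M N : ℕ}
    (hM : 0 < M) (hMx : M ≤ x) (hxN : x * M ≤ N + 1) :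
    x ^ (-s) * ∫ y in (M:ℝ)⁻¹..M, y ^ (-s) / (1 + y) ≤
      ∑ n ∈ Finset.range N, ((n:ℝ) + 1) ^ (-s) / (x + (n + 1)) := by
  have hM1 : (1:ℝ) ≤ M := by exact_mod_cast hM
  have hM0 : (0:ℝ) < M := by linarith
  have hx : 0 < x := by linarith
  have hMM : (M:ℝ)⁻¹ ≤ M := (inv_le_one_of_one_le₀ hM1).trans hM1
  have hanti : AntitoneOn (fun y : ℝ ↦ y ^ (-s) / (x + y)) (Set.Ioi 0) := by
    intro y hy z hz hyz
    have hy : 0 < y := hy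
    have h1 : z ^ (-s) ≤ y ^ (-s) := rpow_le_rpow_of_nonpos hy hyz (by linarith)
    dsimp only
    gcongr
  have hlow : 1 ≤ x * (M:ℝ)⁻¹ := by
    rw [← div_eq_mul_inv, le_div_iff₀ hM0]; linarith
  have hscale : x ^ (-s) * ∫ y in (M:ℝ)⁻¹..M, y ^ (-s) / (1 + y) =
      ∫ y in (x * (M:ℝ)⁻¹)..(x * M), y ^ (-s) / (x + y) := by
    have h := intervalIntegral.integral_comp_mul_left (a := (M:ℝ)⁻¹) (b := M)
      (fun y : ℝ ↦ y ^ (-s) / (x + y)) hx.ne'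
    rw [smul_eq_mul, eq_inv_mul_iff_mul_eq₀ hx.ne', ← intervalIntegral.integral_const_mul] at h
    rw [← h, ← intervalIntegral.integral_const_mul]
    refine intervalIntegral.integral_congr fun y hy ↦ ?_
    rw [Set.uIcc_of_le hMM] at hy
    have hy0 : 0 < y := lt_of_lt_of_le (by positivity) hy.1
    rw [mul_rpow hx.le hy0.le]
    field_simp
  rw [hscale]
  have hsub : Set.Icc (1:ℝ) (1 + N) ⊆ Set.Ioi 0 := fun y hy ↦ lt_of_lt_of_le one_pos hy.1
  calc _ ≤ ∫ y in (1:ℝ)..(1 + N), y ^ (-s) / (x + y) := by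
        refine intervalIntegral.integral_mono_interval hlow
          (by gcongr) (by linarith) ?_ ?_
        · refine (ae_restrict_mem measurableSet_Ioc).mono fun t ht ↦ ?_
          have : 0 < t := one_pos.trans ht.1
          simp only [Pi.zero_apply]
          positivity
        · refine (hanti.mono ?_).intervalIntegrable
          rwa [Set.uIcc_of_le (by linarith [Nat.cast_nonneg (α := ℝ) N])]
    _ ≤ ∑ n ∈ Finset.range N, ((1 + n : ℝ)) ^ (-s) / (x + (1 + n)) :=
        (hanti.mono hsub).integral_le_sum
    _ = _ := by simp_rw [add_comm (1:ℝ)]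

theorem le_of_forall_mul_le_mul_add {x y B : ℝ} {u : ℕ → ℝ}
    (hu : Filter.Tendsto u Filter.atTop Filter.atTop) (h : ∀ k, x * u k ≤ y * u k + B) :
    x ≤ y := by
  by_contra! hxy
  obtain ⟨k, hk⟩ := (hu.eventually_gt_atTop (B / (x - y))).exists
  rw [div_lt_iff₀ (sub_pos.2 hxy)] at hk
  linarith [h k]

theorem sum_range_mul_one_div_succ_le (M K : ℕ) :
    ∑ n ∈ Finset.range (M * K), 1 / ((n:ℝ) + 1) ≤
      ∑ n ∈ Finset.range K, 1 / ((n:ℝ) + 1) + M := by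
  rcases Nat.eq_zero_or_pos M with rfl | hM
  · simpa using Finset.sum_nonneg fun (n : ℕ) _ ↦ by positivity
  rw [← Finset.sum_range_add_sum_Ico _ (Nat.le_mul_of_pos_left K hM)]
  gcongr
  rcases Nat.eq_zero_or_pos K with rfl | hK
  · simp
  have hK' : (0:ℝ) < K := by exact_mod_cast hK
  calc _ ≤ ∑ n ∈ Finset.Ico K (M * K), 1 / (K:ℝ) := by
        refine Finset.sum_le_sum fun n hn ↦ ?_
        have : (K:ℝ) ≤ n := by exact_mod_cast (Finset.mem_Ico.1 hn).1
        gcongr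
        linarith
    _ = ((M * K - K : ℕ) : ℝ) / K := by simp [div_eq_mul_inv]
    _ ≤ M := by
      rw [div_le_iff₀ hK']
      exact_mod_cast Nat.sub_le _ _

theorem le_of_moment_operator_bound {p α G L C' : ℝ} (hp : 1 < p) (hα : -1 < α)
    (hα' : α < p - 1) (hG : 0 ≤ G) (hL0 : 0 ≤ L) {Λ : ℕ → ℝ} (hΛ0 : ∀ k, 0 ≤ Λ k)
    (hΛ : ∀ k, Λ k ≤ G / (k + 1)) (hL : ∀ᶠ k : ℕ in Filter.atTop, L / (k + 1) ≤ Λ k)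
    (hC' : ∀ a : ℕ → ℝ, Summable (fun n : ℕ => ((n : ℝ) + 1) ^ α * |a n| ^ p) →
      (∑' m : ℕ, ((m : ℝ) + 1) ^ α * |∑' n : ℕ, a n * Λ (m + n + 1)| ^ p) ^ (1 / p) ≤
        C' * (∑' n : ℕ, ((n : ℝ) + 1) ^ α * |a n| ^ p) ^ (1 / p)) :
    L * (π / sin (π * ((1 + α) / p))) ≤ C' := by
  set s := (1 + α) / p
  have hp0 : 0 < p := by linarith
  have hs : 0 < s := div_pos (by linarith) hp0
  have hs1 : s < 1 := (div_lt_one hp0).2 (by linarith)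
  have hsp : s * p = 1 + α := div_mul_cancel₀ _ hp0.ne'
  have hweight : ∀ n : ℕ, ((n:ℝ) + 1) ^ α * (((n:ℝ) + 1) ^ (-s)) ^ p = 1 / ((n:ℝ) + 1) := by
    intro n
    have hn : (0:ℝ) < n + 1 := by positivity
    rw [← rpow_mul hn.le, ← rpow_add hn, one_div, ← rpow_neg_one]
    congr 1
    linarith
  obtain ⟨k₀, hk₀⟩ := Filter.eventually_atTop.1 hL
  refine le_of_tendsto
    ((tendsto_integral_inv_rpow_neg_div_one_add hs hs1).const_mul L) ?_
  filter_upwards [Filter.eventually_ge_atTop (k₀ + 1)] with M hM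
  have hM0 : 0 < M := by omega
  set J := ∫ y in (M:ℝ)⁻¹..M, y ^ (-s) / (1 + y)
  have hJ : 0 ≤ J := by
    have hM1 : (1:ℝ) ≤ M := by exact_mod_cast hM0
    refine intervalIntegral.integral_nonneg ((inv_le_one_of_one_le₀ hM1).trans hM1) fun y hy ↦ ?_
    have : 0 < y := lt_of_lt_of_le (by positivity) hy.1
    positivity
  let a : ℕ → ℕ → ℝ := fun K n ↦ if n < M * K then ((n:ℝ) + 1) ^ (-s) else 0
  have ha_out : ∀ K n, n ∉ Finset.range (M * K) → a K n = 0 := by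
    intro K n hn
    simp only [a, if_neg (fun h ↦ hn (Finset.mem_range.2 h))]
  have ha_in : ∀ K n, n ∈ Finset.range (M * K) → a K n = ((n:ℝ) + 1) ^ (-s) := by
    intro K n hn
    simp only [a, if_pos (Finset.mem_range.1 hn)]
  have ha_norm : ∀ K, HasSum (fun n : ℕ => ((n : ℝ) + 1) ^ α * |a K n| ^ p)
      (∑ n ∈ Finset.range (M * K), 1 / ((n:ℝ) + 1)) := by
    intro K
    have h : HasSum (fun n : ℕ => ((n : ℝ) + 1) ^ α * |a K n| ^ p)
        (∑ n ∈ Finset.range (M * K), ((n : ℝ) + 1) ^ α * |a K n| ^ p) :=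
      hasSum_sum_of_ne_finset_zero (fun n hn ↦ by simp [ha_out K n hn, hp0.ne'])
    rwa [Finset.sum_congr rfl fun n hn ↦ by
      rw [ha_in K n hn, abs_of_nonneg (by positivity), hweight n]] at h
  have hC_nonneg : 0 ≤ C' := by
    have h := hC' (a 1) (ha_norm 1).summable
    rw [(ha_norm 1).tsum_eq] at h
    have hpos : 0 < ∑ n ∈ Finset.range (M * 1), 1 / ((n:ℝ) + 1) :=
      Finset.sum_pos (fun n _ ↦ by positivity) (by simpa using hM0.ne')
    exact nonneg_of_mul_nonneg_left
      (le_trans (rpow_nonneg (tsum_nonneg fun m ↦ by positivity) _) h) (by positivity)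
  have hrow : ∀ K m : ℕ, m ∈ Finset.Ico (M - 1) K →
      ((m:ℝ) + 1) ^ (-s) * (L * J) ≤ ∑' n : ℕ, a K n * Λ (m + n + 1) := by
    intro K m hm
    obtain ⟨hm1, hm2⟩ := Finset.mem_Ico.1 hm
    have hMx : (M:ℝ) ≤ m + 1 := by exact_mod_cast (by omega : M ≤ m + 1)
    have hxN : ((m:ℝ) + 1) * M ≤ ((M * K : ℕ) : ℝ) + 1 := by
      have : (m + 1) * M ≤ M * K := by rw [mul_comm M]; gcongr; omega
      exact_mod_cast this.trans (Nat.le_succ _)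
    rw [tsum_eq_sum (s := Finset.range (M * K)) fun n hn ↦ by rw [ha_out K n hn, zero_mul],
      mul_left_comm]
    refine (mul_le_mul_of_nonneg_left (rpow_neg_mul_integral_le_sum hs hM0 hMx hxN) hL0).trans ?_
    rw [Finset.mul_sum]
    refine Finset.sum_le_sum fun n hn ↦ ?_
    rw [ha_in K n hn, mul_div_left_comm]
    have h := hk₀ (m + n + 1) (by omega)
    push_cast at h
    refine mul_le_mul_of_nonneg_left (le_trans (le_of_eq ?_) h) (by positivity)
    congr 1
    ring
  have hcmp : ∀ K : ℕ, (L * J) ^ p * ∑ m ∈ Finset.Ico (M - 1) K, 1 / ((m:ℝ) + 1) ≤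
      C' ^ p * ∑ n ∈ Finset.range (M * K), 1 / ((n:ℝ) + 1) := by
    intro K
    have h := hC' (a K) (ha_norm K).summable
    have hS := (tsum_moment_rpow_le hp hα hα' hG hΛ0 hΛ (ha_norm K).summable).1
    rw [(ha_norm K).tsum_eq] at h
    have hT0 : 0 ≤ ∑' m : ℕ, ((m : ℝ) + 1) ^ α * |∑' n : ℕ, a K n * Λ (m + n + 1)| ^ p :=
      tsum_nonneg fun m ↦ by positivity
    have hN0 : 0 ≤ ∑ n ∈ Finset.range (M * K), 1 / ((n:ℝ) + 1) :=
      Finset.sum_nonneg fun n _ ↦ by positivity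
    have h2 := rpow_le_rpow (rpow_nonneg hT0 _) h hp0.le
    rw [mul_rpow hC_nonneg (rpow_nonneg hN0 _), ← rpow_mul hT0, ← rpow_mul hN0,
      one_div_mul_cancel hp0.ne', rpow_one, rpow_one] at h2
    refine le_trans ?_ h2
    refine le_trans ?_ (hS.sum_le_tsum (Finset.Ico (M - 1) K) fun m _ ↦ by positivity)
    rw [Finset.mul_sum]
    refine Finset.sum_le_sum fun m hm ↦ ?_
    rw [← hweight m, mul_left_comm, ← mul_rpow (by positivity) (by positivity),
      mul_comm (L * J)]
    have := (hrow K m hm).trans (le_abs_self _)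
    gcongr
  refine (rpow_le_rpow_iff (by positivity) hC_nonneg hp0).1 ?_
  refine le_of_forall_mul_le_mul_add (B := (L * J) ^ p * M + C' ^ p * M)
    tendsto_sum_range_one_div_nat_succ_atTop fun K ↦ ?_
  have hsplit : ∑ m ∈ Finset.range K, 1 / ((m:ℝ) + 1) ≤
      M + ∑ m ∈ Finset.Ico (M - 1) K, 1 / ((m:ℝ) + 1) := by
    calc _ ≤ ∑ m ∈ Finset.range (M - 1) ∪ Finset.Ico (M - 1) K, 1 / ((m:ℝ) + 1) := by
          refine Finset.sum_le_sum_of_subset_of_nonneg (fun m hm ↦ ?_)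
            fun m _ _ ↦ by positivity
          simp only [Finset.mem_union, Finset.mem_range, Finset.mem_Ico] at hm ⊢
          omega
      _ = ∑ m ∈ Finset.range (M - 1), 1 / ((m:ℝ) + 1) +
          ∑ m ∈ Finset.Ico (M - 1) K, 1 / ((m:ℝ) + 1) :=
        Finset.sum_union (Finset.disjoint_left.2 fun m hm hm' ↦ by
          simp only [Finset.mem_range, Finset.mem_Ico] at hm hm'
          omega)
      _ ≤ _ := by
        gcongr
        refine (Finset.sum_le_card_nsmul _ _ 1 fun m _ ↦ ?_).trans ?_
        · exact div_le_one_of_le₀ (by linarith [Nat.cast_nonneg (α := ℝ) m]) (by positivity)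
        · simp
  have h1 := mul_le_mul_of_nonneg_left hsplit (by positivity : 0 ≤ (L * J) ^ p)
  have h2 := mul_le_mul_of_nonneg_left (sum_range_mul_one_div_succ_le M K)
    (by positivity : 0 ≤ C' ^ p)
  linarith [hcmp K]

theorem intervalIntegrable_of_monotoneOn_Ico {g : ℝ → ℝ} (hg : MonotoneOn g (Set.Ico (0:ℝ) 1))
    (hb : BddAbove (g '' Set.Ico (0:ℝ) 1)) : IntervalIntegrable g volume 0 1 := by
  let h : ℝ → ℝ := fun t ↦ if t < 1 then g t else sSup (g '' Set.Ico (0:ℝ) 1)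
  have hh : MonotoneOn h (Set.uIcc 0 1) := by
    rw [Set.uIcc_of_le zero_le_one]
    intro x hx y hy hxy
    simp only [h]
    split_ifs with h1 h2 h2
    · exact hg ⟨hx.1, h1⟩ ⟨hy.1, h2⟩ hxy
    · exact le_csSup hb ⟨x, ⟨hx.1, h1⟩, rfl⟩
    · exact absurd (hxy.trans_lt h2) h1
    · exact le_rfl
  refine hh.intervalIntegrable.congr_ae ?_
  have hne : ∀ᵐ t : ℝ ∂volume, t ≠ 1 := by simp [ae_iff]
  rw [Filter.EventuallyEq, ae_restrict_iff' measurableSet_uIoc]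
  filter_upwards [hne] with t ht htI
  rw [Set.uIoc_of_le zero_le_one] at htI
  simp only [h, if_pos (lt_of_le_of_ne htI.2 ht)]

theorem stmt_10 (p α : ℝ) (hp : 1 < p) (hα : -1 < α) (hα' : α < p - 1)
    (g : ℝ → ℝ) (hg0 : ∀ t ∈ Set.Ico (0:ℝ) 1, 0 ≤ g t)
    (hgmono : MonotoneOn g (Set.Ico (0:ℝ) 1))
    (hgbdd : BddAbove (g '' Set.Ico (0:ℝ) 1))
    (hgpos : 0 < sSup (g '' Set.Ico (0:ℝ) 1)) :
    (∀ a : ℕ → ℝ, Summable (fun n : ℕ => ((n : ℝ) + 1) ^ α * |a n| ^ p) →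
      (∑' m : ℕ, ((m : ℝ) + 1) ^ α *
          |∑' n : ℕ, a n * ∫ t in (0:ℝ)..1, t ^ (m + n + 1) * g t| ^ p) ^ (1/p)
        ≤ (sSup (g '' Set.Ico (0:ℝ) 1) * π * (Real.sin (π * (1 + α) / p))⁻¹) *
            (∑' n : ℕ, ((n : ℝ) + 1) ^ α * |a n| ^ p) ^ (1/p))
    ∧
    (∀ C' : ℝ,
      (∀ a : ℕ → ℝ, Summable (fun n : ℕ => ((n : ℝ) + 1) ^ α * |a n| ^ p) →
        (∑' m : ℕ, ((m : ℝ) + 1) ^ α *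
            |∑' n : ℕ, a n * ∫ t in (0:ℝ)..1, t ^ (m + n + 1) * g t| ^ p) ^ (1/p)
          ≤ C' * (∑' n : ℕ, ((n : ℝ) + 1) ^ α * |a n| ^ p) ^ (1/p)) →
      sSup (g '' Set.Ico (0:ℝ) 1) * π * (Real.sin (π * (1 + α) / p))⁻¹ ≤ C') := by
  set G := sSup (g '' Set.Ico (0:ℝ) 1)
  have hp0 : 0 < p := by linarith
  have hconst : G * π * (sin (π * (1 + α) / p))⁻¹ = G * (π / sin (π * ((1 + α) / p))) := by
    rw [mul_div_assoc π, mul_assoc, div_eq_mul_inv π]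
  rw [hconst]
  have hC : 0 < π / sin (π * ((1 + α) / p)) := by
    have hs : 0 < (1 + α) / p := div_pos (by linarith) hp0
    have hs1 : (1 + α) / p < 1 := (div_lt_one hp0).2 (by linarith)
    exact div_pos pi_pos (sin_pos_of_pos_of_lt_pi (by positivity) (by nlinarith [pi_pos]))
  set Λ : ℕ → ℝ := fun k ↦ ∫ t in (0:ℝ)..1, t ^ k * g t with hΛ_def
  have hgint := intervalIntegrable_of_monotoneOn_Ico hgmono hgbdd
  have hint : ∀ k : ℕ, IntervalIntegrable (fun t ↦ t ^ k * g t) volume 0 1 := fun k ↦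
    hgint.continuousOn_mul (by fun_prop)
  have hΛ0 : ∀ k, 0 ≤ Λ k := by
    intro k
    have h := intervalIntegral.integral_mono_on_of_le_Ioo zero_le_one
      (intervalIntegrable_const (c := (0:ℝ))) (hint k) fun t ht ↦
        mul_nonneg (pow_nonneg ht.1.le k) (hg0 t ⟨ht.1.le, ht.2⟩)
    simpa using h
  have hΛ : ∀ k : ℕ, Λ k ≤ G / (k + 1) := by
    intro k
    have h := intervalIntegral.integral_mono_on_of_le_Ioo zero_le_one (hint k)
      (g := fun t ↦ t ^ k * G) (by apply Continuous.intervalIntegrable; fun_prop)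
      fun t ht ↦ mul_le_mul_of_nonneg_left
        (le_csSup hgbdd ⟨t, ⟨ht.1.le, ht.2⟩, rfl⟩) (pow_nonneg ht.1.le k)
    refine h.trans_eq ?_
    rw [intervalIntegral.integral_mul_const, integral_pow]
    simp [div_eq_mul_inv, mul_comm]
  refine ⟨fun a ha ↦ ?_, fun C' hC' ↦ ?_⟩
  · obtain ⟨-, h⟩ := tsum_moment_rpow_le hp hα hα' hgpos.le hΛ0 hΛ ha
    have hN0 : 0 ≤ ∑' n : ℕ, ((n : ℝ) + 1) ^ α * |a n| ^ p :=
      tsum_nonneg fun n ↦ by positivity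
    have h2 := rpow_le_rpow (tsum_nonneg fun m ↦ by positivity) h
      (by positivity : 0 ≤ 1 / p)
    rwa [mul_rpow (by positivity) hN0, ← rpow_mul (by positivity), mul_one_div_cancel hp0.ne',
      rpow_one] at h2
  · rw [← le_div_iff₀ hC]
    refine le_of_forall_lt_imp_le_of_dense fun L hLG ↦ ?_
    rcases lt_or_ge L 0 with hL0 | hL0
    · have h := le_of_moment_operator_bound (L := 0) hp hα hα' hgpos.le le_rfl hΛ0 hΛ
        (Filter.Eventually.of_forall fun k ↦ by simpa using hΛ0 k) hC'
      rw [zero_mul] at h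
      exact hL0.le.trans (div_nonneg h hC.le)
    rw [le_div_iff₀ hC]
    refine le_of_moment_operator_bound hp hα hα' hgpos.le hL0 hΛ0 hΛ ?_ hC'
    obtain ⟨_, ⟨r, hr, rfl⟩, hLr⟩ := exists_lt_of_lt_csSup
      ((Set.nonempty_Ico.2 zero_lt_one).image g) hLG
    have hlow : ∀ k : ℕ, g r * (1 - r ^ (k + 1)) / (k + 1) ≤ Λ k := by
      intro k
      have hsubint : ∀ {u v : ℝ}, u ∈ Set.Icc (0:ℝ) 1 → v ∈ Set.Icc (0:ℝ) 1 →
          IntervalIntegrable (fun t ↦ t ^ k * g t) volume u v := fun hu hv ↦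
        (hint k).mono_set (by
          rw [Set.uIcc_of_le (zero_le_one (α := ℝ))]
          exact Set.uIcc_subset_Icc hu hv)
      have hrI : r ∈ Set.Icc (0:ℝ) 1 := ⟨hr.1, hr.2.le⟩
      have h0I : (0:ℝ) ∈ Set.Icc (0:ℝ) 1 := ⟨le_rfl, zero_le_one⟩
      have h1I : (1:ℝ) ∈ Set.Icc (0:ℝ) 1 := ⟨zero_le_one, le_rfl⟩
      have hsplit := intervalIntegral.integral_add_adjacent_intervals
        (hsubint h0I hrI) (hsubint hrI h1I)
      have hfst : 0 ≤ ∫ t in (0:ℝ)..r, t ^ k * g t :=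
        intervalIntegral.integral_nonneg hr.1 fun t ht ↦
          mul_nonneg (pow_nonneg ht.1 k) (hg0 t ⟨ht.1, ht.2.trans_lt hr.2⟩)
      have h := intervalIntegral.integral_mono_on_of_le_Ioo hr.2.le
        (f := fun t ↦ t ^ k * g r) (by apply Continuous.intervalIntegrable; fun_prop)
        (hsubint hrI h1I) fun t ht ↦ mul_le_mul_of_nonneg_left
          (hgmono hr ⟨hr.1.trans ht.1.le, ht.2⟩ ht.1.le) (pow_nonneg (hr.1.trans ht.1.le) k)
      rw [intervalIntegral.integral_mul_const, integral_pow, one_pow] at h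
      have e : g r * (1 - r ^ (k + 1)) / (k + 1) = (1 - r ^ (k + 1)) / (k + 1) * g r := by ring
      rw [e]
      simp only [hΛ_def]
      linarith
    have hlim : Filter.Tendsto (fun k : ℕ ↦ g r * (1 - r ^ (k + 1))) Filter.atTop
        (nhds (g r)) := by
      have h := ((Filter.tendsto_add_atTop_iff_nat 1).2
        (tendsto_pow_atTop_nhds_zero_of_lt_one hr.1 hr.2)).const_sub 1 |>.const_mul (g r)
      simpa using h
    filter_upwards [hlim.eventually_const_le hLr] with k hk
    refine le_trans ?_ (hlow k)
    gcongr
end
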